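/- arXiv:0912.5028 — 5 statements merged into one kernel-verified Lean document; each statement's English description precedes it below -/
import Mathlib

section
/- For every Coxeter element c of W and every reflection t ∈ T, one has t ≤_T c. Consequently, for every reflection t, the rank-one parabolic subgroup ⟨t⟩ = {1, t} is noncrossing with respect to every Coxeter element of W. -/
open CoxeterSystem

variable {B : Type*} {W : Type*} [Group W] {M : CoxeterMatrix B}

/-- The absolute length of `w`: the minimal length of a word in the reflections
`T = {w s w⁻¹ : s ∈ S, w ∈ W}` whose product is `w`. -/
noncomputable def absLength (cs : CoxeterSystem M W) (w : W) : ℕ :=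
  sInf {k : ℕ | ∃ l : List W, (∀ t ∈ l, cs.IsReflection t) ∧ l.length = k ∧ l.prod = w}

/-- The absolute order on `W`: `u ≤_T v` iff `ℓ_T(u) + ℓ_T(u⁻¹ v) = ℓ_T(v)`. -/
def absLe (cs : CoxeterSystem M W) (u v : W) : Prop :=
  absLength cs u + absLength cs (u⁻¹ * v) = absLength cs v

/-- A Coxeter element: a product of all the simple reflections, each occurring exactly
once, in some order. -/
def IsCoxeterElement (cs : CoxeterSystem M W) (c : W) : Prop :=
  ∃ l : List B, l.Nodup ∧ (∀ i : B, i ∈ l) ∧ (l.map cs.simple).prod = c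

/-- A parabolic subgroup: a subgroup conjugate in `W` to the subgroup generated by a
subset of the simple reflections. -/
def IsParabolic (cs : CoxeterSystem M W) (W' : Subgroup W) : Prop :=
  ∃ (w : W) (J : Set B),
    W' = (Subgroup.closure (cs.simple '' J)).map (MulAut.conj w).toMonoidHom

/-- `W'` is noncrossing with respect to `c`: there is an element `x ≤_T c` and a reduced
`T`-word `t₁ ⋯ t_k` for `x` with `W' = ⟨t₁, …, t_k⟩`. -/
def IsNoncrossing (cs : CoxeterSystem M W) (c : W) (W' : Subgroup W) : Prop :=
  ∃ (x : W) (l : List W), absLe cs x c ∧ (∀ t ∈ l, cs.IsReflection t) ∧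
    l.prod = x ∧ l.length = absLength cs x ∧ W' = Subgroup.closure {t : W | t ∈ l}

open scoped Real

/-- The values `sin (k π / m) / sin (π / m)` (with limit `k` when `m = 0`), characterised by their
three-term recurrence. -/
theorem exists_sin_ratio_seq (m : ℕ) (hm : m ≠ 1) :
    ∃ c : ℕ → ℝ, c 0 = 0 ∧ c 1 = 1 ∧ (∀ k, c (k + 2) = 2 * Real.cos (π / m) * c (k + 1) - c k) ∧
      (∀ k, (m = 0 ∨ k ≤ m) → 0 ≤ c k) ∧ (m ≠ 0 → c m = 0) := by
  rcases Nat.eq_zero_or_pos m with rfl | hpos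
  · refine ⟨fun k => k, by simp, by simp, fun k => ?_, fun k _ => by positivity, by simp⟩
    push_cast
    simp only [div_zero, Real.cos_zero]
    ring
  · have hm2 : (2 : ℝ) ≤ m := by exact_mod_cast (by lia : 2 ≤ m)
    have hm0 : (0 : ℝ) < m := by linarith
    have hsin : 0 < Real.sin (π / m) := by
      apply Real.sin_pos_of_pos_of_lt_pi (by positivity)
      rw [div_lt_iff₀ hm0]
      nlinarith [Real.pi_pos]
    refine ⟨fun k => Real.sin (k * (π / m)) / Real.sin (π / m), by simp,
      by simp [hsin.ne'], fun k => ?_, fun k hk => ?_, fun _ => ?_⟩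
    · dsimp only
      have h1 : ((k + 2 : ℕ) : ℝ) * (π / m) = ((k + 1 : ℕ) : ℝ) * (π / m) + π / m := by
        push_cast; ring
      have h2 : (k : ℝ) * (π / m) = ((k + 1 : ℕ) : ℝ) * (π / m) - π / m := by
        push_cast; ring
      rw [h1, h2, Real.sin_add, Real.sin_sub]
      ring
    · have hk' : (k : ℝ) ≤ m := by exact_mod_cast (by lia : k ≤ m)
      apply div_nonneg _ hsin.le
      apply Real.sin_nonneg_of_nonneg_of_le_pi (by positivity)
      rw [mul_div_assoc', div_le_iff₀ hm0]
      nlinarith [Real.pi_pos]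
    · simp [mul_div_cancel₀ π hm0.ne']

section GeometricRepresentation

variable [Fintype B] [DecidableEq B]

/-- The canonical bilinear form of a Coxeter matrix, normalised so that `⟨αᵢ, αᵢ⟩ = 2`. -/
noncomputable def CoxeterMatrix.bilinForm (M : CoxeterMatrix B) :
    LinearMap.BilinForm ℝ (B → ℝ) :=
  Matrix.toBilin' (Matrix.of fun i j => -2 * Real.cos (π / M i j))

/-- The simple root indexed by `i`. -/
def simpleRoot (i : B) : B → ℝ := Pi.single i 1

/-- The reflection in the root `x` with respect to the canonical bilinear form. -/
noncomputable def CoxeterMatrix.rootReflection (M : CoxeterMatrix B) (x : B → ℝ) :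
    Module.End ℝ (B → ℝ) :=
  LinearMap.id - (M.bilinForm x).smulRight x

theorem CoxeterMatrix.rootReflection_apply (M : CoxeterMatrix B) (x v : B → ℝ) :
    M.rootReflection x v = v - M.bilinForm x v • x := rfl

theorem CoxeterMatrix.bilinForm_simpleRoot (M : CoxeterMatrix B) (i j : B) :
    M.bilinForm (simpleRoot i) (simpleRoot j) = -2 * Real.cos (π / M i j) := by
  simp [CoxeterMatrix.bilinForm, simpleRoot, Matrix.toBilin'_single]

theorem CoxeterMatrix.bilinForm_simpleRoot_self (M : CoxeterMatrix B) (i : B) :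
    M.bilinForm (simpleRoot i) (simpleRoot i) = 2 := by
  simp [CoxeterMatrix.bilinForm_simpleRoot]

theorem CoxeterMatrix.bilinForm_comm (M : CoxeterMatrix B) (u v : B → ℝ) :
    M.bilinForm u v = M.bilinForm v u := by
  have h : (M.bilinForm).IsSymm := by
    rw [CoxeterMatrix.bilinForm, Matrix.isSymm_toBilin'_iff_isSymm]
    ext i j
    simp [M.symmetric i j]
  exact h.eq u v

theorem CoxeterMatrix.rootReflection_simpleRoot_self (M : CoxeterMatrix B) (i : B) :
    M.rootReflection (simpleRoot i) (simpleRoot i) = -simpleRoot i := by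
  rw [M.rootReflection_apply, M.bilinForm_simpleRoot_self]
  module

theorem CoxeterMatrix.rootReflection_mul_self (M : CoxeterMatrix B) (i : B) :
    M.rootReflection (simpleRoot i) * M.rootReflection (simpleRoot i) = 1 := by
  refine LinearMap.ext fun v => ?_
  simp only [Module.End.mul_apply, M.rootReflection_apply, map_sub, map_smul,
    M.bilinForm_simpleRoot_self, Module.End.one_apply, smul_eq_mul]
  module

theorem CoxeterMatrix.isLiftable_rootReflection (M : CoxeterMatrix B) :
    M.IsLiftable fun i => M.rootReflection (simpleRoot i) := by
  intro i j
  by_cases hij : M i j = 1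
  · obtain rfl : i = j := by
      by_contra h
      exact M.off_diagonal i j h hij
    rw [hij, pow_one, M.rootReflection_mul_self]
  obtain ⟨c, h0, h1, hrec, -, hm⟩ := exists_sin_ratio_seq _ hij
  rcases eq_or_ne (M i j) 0 with hz | hz
  · rw [hz, pow_zero]
  set C := Real.cos (π / M i j)
  have hsq (k : ℕ) : c (k + 1) ^ 2 - 2 * C * c k * c (k + 1) + c k ^ 2 = 1 := by
    induction k with
    | zero => simp [h0, h1]
    | succ k ih => rw [hrec k]; linear_combination ih
  have hformij : M.bilinForm (simpleRoot i) (simpleRoot j) = -2 * C := M.bilinForm_simpleRoot i j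
  have hformji : M.bilinForm (simpleRoot j) (simpleRoot i) = -2 * C := by
    rw [M.bilinForm_comm, hformij]
  have key (k : ℕ) (v : B → ℝ) :
      ((M.rootReflection (simpleRoot i) * M.rootReflection (simpleRoot j)) ^ k) v =
        v - (c k * (M.bilinForm (simpleRoot i) v * c k +
              M.bilinForm (simpleRoot j) v * c (k + 1))) • simpleRoot i
          - (c k * (M.bilinForm (simpleRoot i) v * (2 * C * c k - c (k + 1)) +
              M.bilinForm (simpleRoot j) v * c k)) • simpleRoot j := by
    induction k with
    | zero => simp [h0]
    | succ k ih =>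
      rw [pow_succ', Module.End.mul_apply, ih, Module.End.mul_apply]
      simp only [M.rootReflection_apply, map_sub, map_smul, hformij, hformji,
        M.bilinForm_simpleRoot_self, smul_eq_mul, hrec k]
      match_scalars
      · rfl
      · linear_combination (M.bilinForm (simpleRoot i) v +
          2 * C * M.bilinForm (simpleRoot j) v) * hsq k
      · linear_combination M.bilinForm (simpleRoot j) v * hsq k
  refine LinearMap.ext fun v => ?_
  rw [key, hm hz]
  simp

namespace CoxeterSystem

/-- The geometric representation of a Coxeter system. -/
noncomputable def geomRep (cs : CoxeterSystem M W) : W →* Module.End ℝ (B → ℝ) :=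
  cs.lift ⟨_, M.isLiftable_rootReflection⟩

theorem geomRep_simple (cs : CoxeterSystem M W) (i : B) :
    cs.geomRep (cs.simple i) = M.rootReflection (simpleRoot i) :=
  cs.lift_apply_simple M.isLiftable_rootReflection i

theorem geomRep_mul_apply (cs : CoxeterSystem M W) (w x : W) (v : B → ℝ) :
    cs.geomRep (w * x) v = cs.geomRep w (cs.geomRep x v) := by
  rw [map_mul, Module.End.mul_apply]

theorem geomRep_mul_simple_simpleRoot (cs : CoxeterSystem M W) (w : W) (i : B) :
    cs.geomRep (w * cs.simple i) (simpleRoot i) = -cs.geomRep w (simpleRoot i) := by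
  rw [cs.geomRep_mul_apply, cs.geomRep_simple, M.rootReflection_simpleRoot_self, map_neg]

theorem geomRep_inv_apply_apply (cs : CoxeterSystem M W) (w : W) (v : B → ℝ) :
    cs.geomRep w⁻¹ (cs.geomRep w v) = v := by
  rw [← cs.geomRep_mul_apply, inv_mul_cancel, map_one, Module.End.one_apply]

theorem geomRep_apply_inv_apply (cs : CoxeterSystem M W) (w : W) (v : B → ℝ) :
    cs.geomRep w (cs.geomRep w⁻¹ v) = v := by
  rw [← cs.geomRep_mul_apply, mul_inv_cancel, map_one, Module.End.one_apply]

theorem bilinForm_geomRep (cs : CoxeterSystem M W) (w : W) (u v : B → ℝ) :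
    M.bilinForm (cs.geomRep w u) (cs.geomRep w v) = M.bilinForm u v := by
  induction w using cs.simple_induction_left generalizing u v with
  | one => simp
  | mul_simple_left w i ih =>
    rw [cs.geomRep_mul_apply, cs.geomRep_mul_apply, ← ih u v, cs.geomRep_simple]
    simp only [M.rootReflection_apply, map_sub, map_smul, LinearMap.sub_apply,
      LinearMap.smul_apply, M.bilinForm_simpleRoot_self, smul_eq_mul]
    rw [M.bilinForm_comm (cs.geomRep w u) (simpleRoot i)]
    ring

theorem geomRep_conj_simple (cs : CoxeterSystem M W) (w : W) (i : B) :
    cs.geomRep (w * cs.simple i * w⁻¹) = M.rootReflection (cs.geomRep w (simpleRoot i)) := by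
  refine LinearMap.ext fun v => ?_
  rw [cs.geomRep_mul_apply, cs.geomRep_mul_apply, cs.geomRep_simple, M.rootReflection_apply,
    M.rootReflection_apply, map_sub, map_smul, cs.geomRep_apply_inv_apply,
    ← cs.bilinForm_geomRep w, cs.geomRep_apply_inv_apply]

theorem geomRep_alternatingWord_simpleRoot (cs : CoxeterSystem M W) (i j : B) (c : ℕ → ℝ)
    (h0 : c 0 = 0) (h1 : c 1 = 1)
    (hrec : ∀ k, c (k + 2) = 2 * Real.cos (π / M i j) * c (k + 1) - c k) (k : ℕ) :
    cs.geomRep (cs.wordProd (alternatingWord i j k)) (simpleRoot i) =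
      if Even k then c (k + 1) • simpleRoot i + c k • simpleRoot j
      else c k • simpleRoot i + c (k + 1) • simpleRoot j := by
  induction k with
  | zero => simp [alternatingWord, h0, h1]
  | succ k ih =>
    have hij := M.bilinForm_simpleRoot i j
    have hji := M.bilinForm_comm (simpleRoot j) (simpleRoot i)
    rw [hij] at hji
    rw [alternatingWord_succ', cs.wordProd_cons, cs.geomRep_mul_apply, ih, cs.geomRep_simple,
      M.rootReflection_apply]
    by_cases hk : Even k
    · have hk' : ¬ Even (k + 1) := by simpa [Nat.even_add_one] using hk
      simp only [if_pos hk, if_neg hk', map_add, map_smul, hji, M.bilinForm_simpleRoot_self,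
        smul_eq_mul, hrec k]
      module
    · have hk' : Even (k + 1) := by simpa [Nat.even_add_one] using hk
      simp only [if_neg hk, if_pos hk', map_add, map_smul, hij, M.bilinForm_simpleRoot_self,
        smul_eq_mul, hrec k]
      module

/-- Roots are positive: if `i` is not a right descent of `w`, then `w αᵢ` has nonnegative
coordinates. -/
theorem geomRep_simpleRoot_nonneg (cs : CoxeterSystem M W) (w : W) (i : B)
    (hi : ¬ cs.IsRightDescent w i) : 0 ≤ cs.geomRep w (simpleRoot i) := by
  induction hn : cs.length w using Nat.strong_induction_on generalizing w i with
  | _ n IH =>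
  subst hn
  rcases eq_or_ne w 1 with rfl | hw
  · simp [simpleRoot]
  obtain ⟨j, hj⟩ := cs.exists_rightDescent_of_ne_one hw
  have hij : i ≠ j := by rintro rfl; exact hi hj
  set a : ℕ → W := fun k => cs.wordProd (alternatingWord i j k) with ha
  have a_succ (k : ℕ) : w * (a (k + 1))⁻¹ =
      w * (a k)⁻¹ * cs.simple (if Even k then j else i) := by
    simp only [ha, alternatingWord_succ', cs.wordProd_cons, mul_inv_rev, cs.inv_simple, mul_assoc]
  have hex : ∃ k, cs.length (w * (a k)⁻¹) + k ≠ cs.length w :=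
    ⟨cs.length w + 1, by lia⟩
  obtain ⟨N, hN, hmin⟩ : ∃ N, cs.length (w * (a N)⁻¹) + N ≠ cs.length w ∧
      ∀ k < N, cs.length (w * (a k)⁻¹) + k = cs.length w := by
    classical
    exact ⟨Nat.find hex, Nat.find_spec hex, fun k hk => not_not.1 (Nat.find_min hex hk)⟩
  have h0 : cs.length (w * (a 0)⁻¹) + 0 = cs.length w := by simp [ha, alternatingWord]
  have h1 : cs.length (w * (a 1)⁻¹) + 1 = cs.length w := by
    simpa [ha, alternatingWord] using cs.isRightDescent_iff.1 hj
  obtain ⟨k, rfl⟩ : ∃ k, N = k + 2 :=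
    ⟨N - 2, by
      rcases N with _ | _ | N
      · exact absurd h0 hN
      · exact absurd h1 hN
      · lia⟩
  have hk := hmin k (by lia)
  have hk1 := hmin (k + 1) (by lia)
  set v := w * (a (k + 1))⁻¹ with hv
  have hvnext : ¬ cs.IsRightDescent v (if Even (k + 1) then j else i) := by
    rw [cs.not_isRightDescent_iff]
    rw [a_succ (k + 1), ← hv] at hN
    rcases cs.length_mul_simple v (if Even (k + 1) then j else i) with h | h <;> lia
  have hvprev : ¬ cs.IsRightDescent v (if Even k then j else i) := by
    rw [cs.not_isRightDescent_iff, hv, a_succ k, cs.simple_mul_simple_cancel_right, ← a_succ k, ← hv]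
    lia
  have hvij : ¬ cs.IsRightDescent v i ∧ ¬ cs.IsRightDescent v j := by
    by_cases hk : Even k <;> simp_all [Nat.even_add_one]
  have hvi := IH (cs.length v) (by lia) v i hvij.1 rfl
  have hvj := IH (cs.length v) (by lia) v j hvij.2 rfl
  obtain ⟨c, c0, c1, crec, cnn, -⟩ := exists_sin_ratio_seq (M i j) (M.off_diagonal i j hij)
  have hkm : M i j = 0 ∨ k + 2 ≤ M i j := by
    by_contra! hcon
    obtain ⟨p, hp⟩ := Nat.exists_eq_succ_of_ne_zero hcon.1
    have hP := hmin (M i j) hcon.2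
    have hbr : a (M i j) = cs.wordProd (alternatingWord i j p) * cs.simple i := by
      have := cs.wordProd_braidWord_eq i j
      rw [braidWord, braidWord, M.symmetric j i, hp, Nat.succ_eq_add_one,
        alternatingWord_succ j i, cs.wordProd_concat] at this
      rw [hp]
      exact this
    have hws : w * cs.simple i = w * (a (M i j))⁻¹ * cs.wordProd (alternatingWord i j p) := by
      rw [hbr]
      simp [mul_assoc]
    have hle := cs.length_mul_le (w * (a (M i j))⁻¹) (cs.wordProd (alternatingWord i j p))
    have hle' := cs.length_wordProd_le (alternatingWord i j p)
    rw [length_alternatingWord] at hle'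
    rw [← hws, cs.not_isRightDescent_iff.1 hi] at hle
    lia
  have hc1 := cnn (k + 1) (by lia)
  have hc2 := cnn (k + 2) (by lia)
  have hw' : w = v * a (k + 1) := by simp [hv]
  rw [hw', cs.geomRep_mul_apply, cs.geomRep_alternatingWord_simpleRoot i j c c0 c1 crec]
  split_ifs
  · rw [map_add, map_smul, map_smul]
    exact add_nonneg (smul_nonneg hc2 hvi) (smul_nonneg hc1 hvj)
  · rw [map_add, map_smul, map_smul]
    exact add_nonneg (smul_nonneg hc1 hvi) (smul_nonneg hc2 hvj)

theorem geomRep_simpleRoot_nonpos (cs : CoxeterSystem M W) (w : W) (i : B)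
    (hi : cs.IsRightDescent w i) : cs.geomRep w (simpleRoot i) ≤ 0 := by
  have h := cs.geomRep_simpleRoot_nonneg _ i (cs.isRightDescent_iff_not_isRightDescent_mul.1 hi)
  rw [cs.geomRep_mul_simple_simpleRoot] at h
  exact neg_nonneg.1 h

theorem geomRep_injective (cs : CoxeterSystem M W) : Function.Injective cs.geomRep := by
  rw [injective_iff_map_eq_one]
  intro w hw
  by_contra hne
  obtain ⟨i, hi⟩ := cs.exists_rightDescent_of_ne_one hne
  have h := cs.geomRep_simpleRoot_nonpos w i hi i
  rw [hw] at h
  simp [simpleRoot] at h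
  linarith

/-- A simple reflection `sⱼ` sends no positive root other than `αⱼ` to a negative root. -/
theorem conj_simple_eq_of_isRightDescent (cs : CoxeterSystem M W) {w : W} {i j : B}
    (h : ¬ cs.IsRightDescent w i) (h' : cs.IsRightDescent (cs.simple j * w) i) :
    w * cs.simple i * w⁻¹ = cs.simple j := by
  set γ := cs.geomRep w (simpleRoot i) with hγ
  have hpos : 0 ≤ γ := cs.geomRep_simpleRoot_nonneg w i h
  have hneg := cs.geomRep_simpleRoot_nonpos _ i h'
  rw [cs.geomRep_mul_apply, ← hγ, cs.geomRep_simple, M.rootReflection_apply] at hneg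
  have hmul : γ = γ j • simpleRoot j := by
    ext k
    rcases eq_or_ne k j with rfl | hk
    · simp [simpleRoot]
    · have h1 := hpos k
      have h2 := hneg k
      simp [simpleRoot, hk] at h1 h2 ⊢
      linarith
  have hnorm : M.bilinForm γ γ = 2 := by
    rw [hγ, cs.bilinForm_geomRep, M.bilinForm_simpleRoot_self]
  rw [hmul] at hnorm
  simp only [map_smul, LinearMap.smul_apply, M.bilinForm_simpleRoot_self, smul_eq_mul] at hnorm
  have hone : γ j = 1 := by
    have := hpos j
    simp only [Pi.zero_apply] at this
    nlinarith
  rw [hone, one_smul] at hmul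
  apply cs.geomRep_injective
  rw [cs.geomRep_conj_simple, ← hγ, hmul, cs.geomRep_simple]


theorem not_isRightDescent_of_notMem_leftInvSeq (cs : CoxeterSystem M W) (ω : List B) {w : W}
    {i : B} (h : ¬ cs.IsRightDescent w i) (hmem : w * cs.simple i * w⁻¹ ∉ cs.leftInvSeq ω) :
    ¬ cs.IsRightDescent ((cs.wordProd ω)⁻¹ * w) i := by
  induction ω generalizing w with
  | nil => simpa using h
  | cons j ω ih =>
    rw [leftInvSeq, List.mem_cons, not_or] at hmem
    have hj : ¬ cs.IsRightDescent (cs.simple j * w) i := fun h' =>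
      hmem.1 (cs.conj_simple_eq_of_isRightDescent h h')
    rw [cs.wordProd_cons, mul_inv_rev, cs.inv_simple, mul_assoc]
    refine ih hj fun h' => hmem.2 (List.mem_map.2 ⟨_, h', ?_⟩)
    simp [mul_assoc]

theorem eq_zero_of_geomRep_simple_fixed [Finite W] (cs : CoxeterSystem M W) {v : B → ℝ}
    (hv : ∀ i, cs.geomRep (cs.simple i) v = v) : v = 0 := by
  cases nonempty_fintype W
  have hfix (w : W) : cs.geomRep w v = v := by
    induction w using cs.simple_induction_left with
    | one => simp
    | mul_simple_left w i ih => rw [cs.geomRep_mul_apply, ih, hv]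
  have hsum : ∑ w : W, cs.geomRep w = 0 := by
    refine (Pi.basisFun ℝ B).ext fun i => ?_
    have h := Equiv.sum_comp (Equiv.mulRight (cs.simple i)) fun w => cs.geomRep w (simpleRoot i)
    simp only [Equiv.coe_mulRight, cs.geomRep_mul_simple_simpleRoot, Finset.sum_neg_distrib] at h
    rw [neg_eq_self] at h
    simpa [simpleRoot, LinearMap.sum_apply] using h
  have h := LinearMap.congr_fun hsum v
  simp only [LinearMap.sum_apply, hfix, Finset.sum_const, LinearMap.zero_apply] at h
  exact (smul_eq_zero.1 h).resolve_left (by simp)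

theorem geomRep_wordProd_apply_of_notMem (cs : CoxeterSystem M W) (ω : List B) (v : B → ℝ)
    {j : B} (hj : j ∉ ω) : cs.geomRep (cs.wordProd ω) v j = v j := by
  induction ω with
  | nil => simp
  | cons i ω ih =>
    rw [List.mem_cons, not_or] at hj
    rw [cs.wordProd_cons, cs.geomRep_mul_apply, cs.geomRep_simple, M.rootReflection_apply]
    simp [simpleRoot, hj.1, ih hj.2]

theorem geomRep_simple_fixed_of_wordProd_fixed (cs : CoxeterSystem M W) {ω : List B}
    (hω : ω.Nodup) {v : B → ℝ} (hv : cs.geomRep (cs.wordProd ω) v = v) {i : B} (hi : i ∈ ω) :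
    cs.geomRep (cs.simple i) v = v := by
  induction ω with
  | nil => simp at hi
  | cons j ω ih =>
    rw [List.nodup_cons] at hω
    rw [cs.wordProd_cons, cs.geomRep_mul_apply] at hv
    have hv' : cs.geomRep (cs.wordProd ω) v = cs.geomRep (cs.simple j) v := by
      rw [← cs.geomRep_inv_apply_apply (cs.simple j) (cs.geomRep (cs.wordProd ω) v), hv,
        cs.inv_simple]
    have hj : cs.geomRep (cs.simple j) v = v := by
      ext k
      by_cases hk : k = j
      · subst hk
        rw [← hv', cs.geomRep_wordProd_apply_of_notMem ω v hω.1]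
      · simpa using cs.geomRep_wordProd_apply_of_notMem [j] v (j := k) (by simpa using hk)
    rcases List.mem_cons.1 hi with rfl | hi
    · exact hj
    · exact ih hω.2 (hv'.trans hj) hi

theorem exists_submodule_of_forall_isReflection (cs : CoxeterSystem M W) (l : List W)
    (hl : ∀ t ∈ l, cs.IsReflection t) :
    ∃ U : Submodule ℝ (B → ℝ), Module.finrank ℝ U ≤ l.length ∧
      ∀ v, cs.geomRep l.prod v - v ∈ U := by
  induction l with
  | nil => exact ⟨⊥, by simp, by simp⟩
  | cons t l ih =>
    obtain ⟨U, hU, hUv⟩ := ih fun u hu => hl u (List.mem_cons_of_mem _ hu)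
    obtain ⟨w, i, rfl⟩ := hl t List.mem_cons_self
    refine ⟨Submodule.span ℝ {cs.geomRep w (simpleRoot i)} ⊔ U, ?_, fun v => ?_⟩
    · have h1 := Submodule.finrank_add_le_finrank_add_finrank
        (Submodule.span ℝ {cs.geomRep w (simpleRoot i)}) U
      have h2 := finrank_span_le_card (R := ℝ) ({cs.geomRep w (simpleRoot i)} : Set (B → ℝ))
      simp only [Set.toFinset_singleton, Finset.card_singleton] at h2
      rw [List.length_cons]
      lia
    · rw [List.prod_cons, cs.geomRep_mul_apply, cs.geomRep_conj_simple, M.rootReflection_apply,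
        sub_right_comm, sub_eq_neg_add]
      refine Submodule.add_mem_sup (Submodule.neg_mem _ (Submodule.smul_mem _ _ ?_)) (hUv v)
      exact Submodule.mem_span_singleton_self _

theorem card_le_length_of_prod_eq [Finite W] (cs : CoxeterSystem M W) {ω : List B}
    (hω : ω.Nodup) (hall : ∀ i, i ∈ ω) {l : List W} (hl : ∀ t ∈ l, cs.IsReflection t)
    (hprod : l.prod = cs.wordProd ω) : Fintype.card B ≤ l.length := by
  obtain ⟨U, hU, hUv⟩ := cs.exists_submodule_of_forall_isReflection l hl
  rw [hprod] at hUv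
  have hinj : Function.Injective (cs.geomRep (cs.wordProd ω) - 1 : Module.End ℝ (B → ℝ)) := by
    rw [injective_iff_map_eq_zero]
    intro v hv
    rw [LinearMap.sub_apply, Module.End.one_apply, sub_eq_zero] at hv
    exact cs.eq_zero_of_geomRep_simple_fixed fun i =>
      cs.geomRep_simple_fixed_of_wordProd_fixed hω hv (hall i)
  have htop : U = ⊤ := by
    rw [eq_top_iff]
    rintro x -
    obtain ⟨v, rfl⟩ := LinearMap.injective_iff_surjective.1 hinj x
    exact hUv v
  subst htop
  simpa using hU

/-- In a finite Coxeter group, the orbit of every reflection under a Coxeter element `c` meets the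
left inversion sequence of each word for `c` in which every simple reflection occurs once. -/
theorem exists_pow_conj_mem_leftInvSeq [Finite W] (cs : CoxeterSystem M W) {ω : List B}
    (hω : ω.Nodup) (hall : ∀ i, i ∈ ω) {t : W} (ht : cs.IsReflection t) :
    ∃ k : ℕ, ((cs.wordProd ω)⁻¹ ^ k) * t * ((cs.wordProd ω)⁻¹ ^ k)⁻¹ ∈ cs.leftInvSeq ω := by
  by_contra! hcon
  set c := cs.wordProd ω with hc
  obtain ⟨w, i, hwi, rfl⟩ : ∃ w i, ¬ cs.IsRightDescent w i ∧ t = w * cs.simple i * w⁻¹ := by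
    obtain ⟨w, i, rfl⟩ := ht
    by_cases h : cs.IsRightDescent w i
    · exact ⟨w * cs.simple i, i, cs.isRightDescent_iff_not_isRightDescent_mul.1 h,
        by simp [mul_assoc]⟩
    · exact ⟨w, i, h, rfl⟩
  have hpos (k : ℕ) : ¬ cs.IsRightDescent (c⁻¹ ^ k * w) i := by
    induction k with
    | zero => simpa using hwi
    | succ k ih =>
      rw [pow_succ', mul_assoc]
      refine cs.not_isRightDescent_of_notMem_leftInvSeq ω ih ?_
      simpa only [mul_inv_rev, mul_assoc] using hcon k
  set γ := cs.geomRep w (simpleRoot i) with hγ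
  have hnn (k : ℕ) : 0 ≤ cs.geomRep (c⁻¹ ^ k) γ := by
    rw [hγ, ← cs.geomRep_mul_apply]
    exact cs.geomRep_simpleRoot_nonneg _ i (hpos k)
  obtain ⟨n, hn, hpow⟩ := isOfFinOrder_iff_pow_eq_one.1 (isOfFinOrder_of_finite c⁻¹)
  set σ := ∑ k ∈ Finset.range n, cs.geomRep (c⁻¹ ^ k) γ with hσ
  have hfix : cs.geomRep c⁻¹ σ = σ := by
    have h := Finset.sum_range_succ' (fun k => cs.geomRep (c⁻¹ ^ k) γ) n
    rw [Finset.sum_range_succ, hpow, pow_zero, add_left_inj] at h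
    rw [hσ, map_sum, h]
    exact Finset.sum_congr rfl fun k _ => by rw [pow_succ', cs.geomRep_mul_apply]
  have hfix' : cs.geomRep c σ = σ := by
    conv_lhs => rw [← hfix]
    exact cs.geomRep_apply_inv_apply c σ
  have hzero : σ = 0 := cs.eq_zero_of_geomRep_simple_fixed fun j =>
    cs.geomRep_simple_fixed_of_wordProd_fixed hω hfix' (hall j)
  have hγ0 : γ = 0 := by
    have h := (Finset.sum_eq_zero_iff_of_nonneg fun k _ => hnn k).1 hzero 0 (by simpa using hn)
    simpa using h
  have h2 := cs.bilinForm_geomRep w (simpleRoot i) (simpleRoot i)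
  rw [← hγ, hγ0, M.bilinForm_simpleRoot_self] at h2
  simp at h2

end CoxeterSystem

end GeometricRepresentation

section AbsoluteLength

theorem absLength_prod_le (cs : CoxeterSystem M W) {l : List W}
    (hl : ∀ t ∈ l, cs.IsReflection t) : absLength cs l.prod ≤ l.length :=
  Nat.sInf_le ⟨l, hl, rfl, rfl⟩

theorem absLength_wordProd_le (cs : CoxeterSystem M W) (ω : List B) :
    absLength cs (cs.wordProd ω) ≤ ω.length := by
  have h := absLength_prod_le cs (l := ω.map cs.simple) fun t ht => by
    obtain ⟨i, -, rfl⟩ := List.mem_map.1 ht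
    exact cs.isReflection_simple i
  simpa [CoxeterSystem.wordProd] using h

theorem exists_reflection_word (cs : CoxeterSystem M W) (w : W) :
    ∃ l : List W, (∀ t ∈ l, cs.IsReflection t) ∧ l.length = absLength cs w ∧ l.prod = w := by
  refine Nat.sInf_mem (s := {k : ℕ | ∃ l : List W, (∀ t ∈ l, cs.IsReflection t) ∧
    l.length = k ∧ l.prod = w}) ?_
  obtain ⟨ω, -, rfl⟩ := cs.exists_isReduced w
  refine ⟨_, ω.map cs.simple, fun t ht => ?_, rfl, rfl⟩
  obtain ⟨i, -, rfl⟩ := List.mem_map.1 ht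
  exact cs.isReflection_simple i

theorem absLength_mul_le (cs : CoxeterSystem M W) (u v : W) :
    absLength cs (u * v) ≤ absLength cs u + absLength cs v := by
  obtain ⟨l, hl, hlen, rfl⟩ := exists_reflection_word cs u
  obtain ⟨l', hl', hlen', rfl⟩ := exists_reflection_word cs v
  rw [← hlen, ← hlen', ← List.prod_append, ← List.length_append]
  exact absLength_prod_le cs fun t ht => (List.mem_append.1 ht).elim (hl t) (hl' t)

theorem absLength_conj_le (cs : CoxeterSystem M W) (g w : W) :
    absLength cs (g * w * g⁻¹) ≤ absLength cs w := by
  obtain ⟨l, hl, hlen, rfl⟩ := exists_reflection_word cs w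
  have hprod : g * l.prod * g⁻¹ = (l.map (MulAut.conj g)).prod := by
    rw [← map_list_prod, MulAut.conj_apply]
  rw [hprod, ← hlen, ← List.length_map (MulAut.conj g)]
  refine absLength_prod_le cs fun t ht => ?_
  obtain ⟨u, hu, rfl⟩ := List.mem_map.1 ht
  exact (hl u hu).conj g

theorem CoxeterSystem.IsReflection.absLength_eq_one {cs : CoxeterSystem M W} {t : W}
    (ht : cs.IsReflection t) : absLength cs t = 1 := by
  have hle : absLength cs t ≤ 1 := by
    simpa using absLength_prod_le cs (l := [t]) (by simpa using ht)
  obtain ⟨l, -, hlen, hprod⟩ := exists_reflection_word cs t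
  have hne : absLength cs t ≠ 0 := by
    intro h0
    rw [h0, List.length_eq_zero_iff] at hlen
    subst hlen
    have := ht.odd_length
    simp [← hprod] at this
  lia

theorem absLength_wordProd_eq_length [Finite W] [Fintype B] (cs : CoxeterSystem M W)
    {ω : List B} (hω : ω.Nodup) (hall : ∀ i, i ∈ ω) :
    absLength cs (cs.wordProd ω) = ω.length := by
  classical
  obtain ⟨l, hl, hlen, hprod⟩ := exists_reflection_word cs (cs.wordProd ω)
  have hge := cs.card_le_length_of_prod_eq hω hall hl hprod
  have hcard : ω.length ≤ Fintype.card B := hω.length_le_card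
  have hle := absLength_wordProd_le cs ω
  lia

theorem absLength_mul_lt_of_mem_leftInvSeq (cs : CoxeterSystem M W) {ω : List B} {t : W}
    (ht : t ∈ cs.leftInvSeq ω) : absLength cs (t * cs.wordProd ω) < ω.length := by
  obtain ⟨j, hj, rfl⟩ := List.mem_iff_getElem.1 ht
  have h := cs.getD_leftInvSeq_mul_wordProd ω j
  rw [List.getD_eq_getElem _ _ hj] at h
  rw [cs.length_leftInvSeq] at hj
  rw [h]
  refine (absLength_wordProd_le cs _).trans_lt ?_
  rw [List.length_eraseIdx_of_lt hj]
  lia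

theorem absLe_wordProd_of_isReflection [Finite W] [Finite B] (cs : CoxeterSystem M W)
    {ω : List B} (hω : ω.Nodup) (hall : ∀ i, i ∈ ω) {t : W} (ht : cs.IsReflection t) :
    absLe cs t (cs.wordProd ω) := by
  cases nonempty_fintype B
  classical
  have hc := absLength_wordProd_eq_length cs hω hall
  obtain ⟨k, hk⟩ := cs.exists_pow_conj_mem_leftInvSeq hω hall ht
  have hlt := absLength_mul_lt_of_mem_leftInvSeq cs hk
  set c := cs.wordProd ω
  have hconj : t * c =
      c ^ k * (c⁻¹ ^ k * t * (c⁻¹ ^ k)⁻¹ * c) * (c ^ k)⁻¹ := by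
    have hcomm : c ^ k * c * (c ^ k)⁻¹ = c := by rw [← pow_succ, pow_succ', mul_inv_cancel_right]
    simp only [inv_pow, inv_inv, mul_assoc, mul_inv_cancel_left]
    rw [← mul_assoc (c ^ k) c, hcomm]
  have hle := absLength_conj_le cs (c ^ k) (c⁻¹ ^ k * t * (c⁻¹ ^ k)⁻¹ * c)
  rw [← hconj] at hle
  have hmul := absLength_mul_le cs t (t * c)
  rw [← mul_assoc, ht.mul_self, one_mul, ht.absLength_eq_one] at hmul
  rw [absLe, ht.inv, ht.absLength_eq_one]
  lia

theorem CoxeterSystem.IsReflection.coe_closure_singleton {cs : CoxeterSystem M W} {t : W}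
    (ht : cs.IsReflection t) : ((Subgroup.closure {t} : Subgroup W) : Set W) = {1, t} := by
  ext x
  rw [SetLike.mem_coe, Subgroup.mem_closure_singleton, Set.mem_insert_iff, Set.mem_singleton_iff]
  constructor
  · rintro ⟨n, rfl⟩
    rcases Int.even_or_odd' n with ⟨m, rfl | rfl⟩
    · left
      rw [zpow_mul, zpow_ofNat, ht.pow_two, one_zpow]
    · right
      rw [zpow_add_one, zpow_mul, zpow_ofNat, ht.pow_two, one_zpow, one_mul]
  · rintro (rfl | rfl)
    · exact ⟨0, zpow_zero _⟩
    · exact ⟨1, zpow_one _⟩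

end AbsoluteLength

/-- For every Coxeter element `c` and every reflection `t`, one has
`t ≤_T c`; consequently the rank-one parabolic subgroup `⟨t⟩ = {1, t}` is noncrossing with
respect to every Coxeter element. -/
theorem reflection_absLe_coxeterElement
    (cs : CoxeterSystem M W) [Finite W] [Finite B] :
    ∀ c : W, IsCoxeterElement cs c → ∀ t : W, cs.IsReflection t →
      absLe cs t c ∧
      ((Subgroup.closure {t} : Subgroup W) : Set W) = {1, t} ∧
      IsNoncrossing cs c (Subgroup.closure {t}) := by
  rintro c ⟨ω, hω, hall, rfl⟩ t ht
  have hle : absLe cs t (cs.wordProd ω) := absLe_wordProd_of_isReflection cs hω hall ht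
  refine ⟨hle, ht.coe_closure_singleton, t, [t], hle, by simpa using ht, by simp, ?_, by simp⟩
  rw [ht.absLength_eq_one, List.length_singleton]
end

section
/- Let n ≥ 1, and for 1 ≤ i ≤ n let s_i denote the adjacent transposition (i, i+1) in the symmetric group on {1, …, n+1}. Let c₊ be the product of the s_i with i odd and c₋ the product of the s_i with i even (each product is independent of the order of its factors, since those factors pairwise commute). Then c = c₋c₊ is an (n+1)-cycle; in particular, c has order n+1 and the cyclic group generated by c acts transitively on {1, …, n+1}. -/
open Equiv in
/-- Adjacent transpositions whose indices have the same parity are disjoint. -/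
theorem disjoint_swap_castSucc_succ {n : ℕ} {i j : Fin n} (hij : i ≠ j)
    (h : i.val % 2 = j.val % 2) :
    Perm.Disjoint (swap i.castSucc i.succ) (swap j.castSucc j.succ) := by
  intro x
  by_cases hx : x = i.castSucc ∨ x = i.succ
  · right
    apply swap_apply_of_ne_of_ne <;> rcases hx with rfl | rfl <;>
      simp only [ne_eq, Fin.ext_iff, Fin.val_castSucc, Fin.val_succ] at * <;> omega
  · left
    rw [not_or] at hx
    exact swap_apply_of_ne_of_ne hx.1 hx.2

open Equiv in
/-- On the points it moves, an adjacent transposition agrees with the product of all adjacent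
transpositions whose indices have the same parity. -/
theorem prod_swap_filter_mod_two_apply {n r : ℕ} (i : Fin n) (hi : i.val % 2 = r) :
    let p := (((List.finRange n).filter (fun i => i.val % 2 = r)).map
      (fun i => swap i.castSucc i.succ)).prod
    p i.castSucc = i.succ ∧ p i.succ = i.castSucc := by
  intro p
  have hne : i.castSucc ≠ i.succ := i.castSucc_lt_succ.ne
  have hp : (((List.finRange n).filter (fun i => i.val % 2 = r)).map
      (fun i => swap i.castSucc i.succ)).Pairwise Perm.Disjoint := by
    rw [List.pairwise_map]
    refine ((List.nodup_finRange n).filter _).imp_of_mem fun {a b} ha hb hab => ?_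
    simp only [List.mem_filter, decide_eq_true_eq] at ha hb
    exact disjoint_swap_castSucc_succ hab (ha.2.trans hb.2.symm)
  have hmem : swap i.castSucc i.succ ∈ ((List.finRange n).filter (fun i => i.val % 2 = r)).map
      (fun i => swap i.castSucc i.succ) :=
    List.mem_map.2 ⟨i, by simp [hi], rfl⟩
  have key := Perm.eq_on_support_mem_disjoint hmem hp
  exact ⟨by rw [← key _ (by simp [Perm.support_swap hne]), swap_apply_left],
    by rw [← key _ (by simp [Perm.support_swap hne]), swap_apply_right]⟩

open Equiv in
theorem prod_swap_filter_odd_apply_zero (n : ℕ) :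
    (((List.finRange n).filter (fun i => i.val % 2 = 1)).map
      (fun i => swap i.castSucc i.succ)).prod 0 = 0 := by
  rw [← Perm.smul_def, ← MulAction.mem_stabilizer_iff]
  refine Subgroup.list_prod_mem _ fun g hg => ?_
  simp only [List.mem_map, List.mem_filter, decide_eq_true_eq] at hg
  obtain ⟨i, ⟨-, hi⟩, rfl⟩ := hg
  apply swap_apply_of_ne_of_ne <;>
    simp only [ne_eq, Fin.ext_iff, Fin.val_castSucc, Fin.val_succ, Fin.val_zero] <;> omega

/-- In the symmetric group on `{1, …, n+1}`, the bipartite Coxeter element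
`c = c₋ c₊`, where `c₊` is the product of the adjacent transpositions `sᵢ = (i, i+1)` with
`i` odd and `c₋` the product of those with `i` even, is an `(n+1)`-cycle; in particular
`c` has order `n+1` and `⟨c⟩` acts transitively on `{1, …, n+1}`. -/
theorem bipartite_coxeter_element_of_symmetric_group_isCycle
    (n : ℕ) (hn : 1 ≤ n)
    (s : Fin n → Equiv.Perm (Fin (n + 1)))
    (hs : ∀ i : Fin n, s i = Equiv.swap i.castSucc i.succ)
    (cplus cminus c : Equiv.Perm (Fin (n + 1)))
    -- `s i` represents the adjacent transposition `(i+1, i+2)`, i.e. `s_{i+1}` in the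
    -- 1-based indexing of the statement; so "`s_j` with `j` odd" means `i.val` even.
    (hcplus : cplus = (((List.finRange n).filter (fun i => i.val % 2 = 0)).map s).prod)
    (hcminus : cminus = (((List.finRange n).filter (fun i => i.val % 2 = 1)).map s).prod)
    (hc : c = cminus * cplus) :
    c.IsCycle ∧ c.support = Finset.univ ∧ orderOf c = n + 1 ∧
      ∀ x y : Fin (n + 1), ∃ k : ℤ, (c ^ k) x = y := by
  obtain rfl : s = fun i => Equiv.swap i.castSucc i.succ := funext hs
  have plus (i : Fin n) (hi : i.val % 2 = 0) :
      cplus i.castSucc = i.succ ∧ cplus i.succ = i.castSucc :=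
    hcplus ▸ prod_swap_filter_mod_two_apply i hi
  have minus (i : Fin n) (hi : i.val % 2 = 1) :
      cminus i.castSucc = i.succ ∧ cminus i.succ = i.castSucc :=
    hcminus ▸ prod_swap_filter_mod_two_apply i hi
  have minus_zero : cminus 0 = 0 := hcminus ▸ prod_swap_filter_odd_apply_zero n
  have one_to_zero : c ⟨1, by omega⟩ = 0 := by
    rw [hc, Equiv.Perm.mul_apply]
    exact (congrArg cminus (plus ⟨0, hn⟩ rfl).2).trans minus_zero
  have even_step (m : ℕ) (hm : m + 2 < n + 1) (he : m % 2 = 0) :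
      c ⟨m, by omega⟩ = ⟨m + 2, hm⟩ := by
    rw [hc, Equiv.Perm.mul_apply]
    exact (congrArg cminus (plus ⟨m, by omega⟩ he).1).trans
      (minus ⟨m + 1, by omega⟩ (by simp only; omega)).1
  have odd_step (m : ℕ) (hm : m + 2 < n + 1) (ho : m % 2 = 1) :
      c ⟨m + 2, hm⟩ = ⟨m, by omega⟩ := by
    rw [hc, Equiv.Perm.mul_apply]
    exact (congrArg cminus (plus ⟨m + 1, by omega⟩ (by simp only; omega)).2).trans
      (minus ⟨m, by omega⟩ ho).2
  have same_zero (m : ℕ) : ∀ hm : m < n + 1, c.SameCycle 0 ⟨m, hm⟩ := by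
    induction m using Nat.twoStepInduction with
    | zero => exact fun _ => Equiv.Perm.SameCycle.refl _ _
    | one => exact fun hm => Equiv.Perm.SameCycle.symm ⟨1, by simpa using one_to_zero⟩
    | more m ih _ =>
      intro hm
      refine (ih (by omega)).trans ?_
      rcases Nat.mod_two_eq_zero_or_one m with he | ho
      · exact ⟨1, by simpa using even_step m hm he⟩
      · exact Equiv.Perm.SameCycle.symm ⟨1, by simpa using odd_step m hm ho⟩
  have same (x y : Fin (n + 1)) : c.SameCycle x y :=
    (same_zero x x.2).symm.trans (same_zero y y.2)
  have : Nontrivial (Fin (n + 1)) := Fin.nontrivial_iff_two_le.2 (by omega)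
  have moved (x : Fin (n + 1)) : c x ≠ x := fun hx => by
    obtain ⟨y, hy⟩ := exists_ne x
    exact hy (((same x y).eq_of_left hx).symm)
  have cycle : c.IsCycle := ⟨0, moved 0, fun y _ => same 0 y⟩
  have support : c.support = Finset.univ := by
    ext x
    simpa using moved x
  exact ⟨cycle, support, by rw [cycle.orderOf, support, Finset.card_fin], same⟩
end

section
/- Let n ≥ 2 and let e₁, …, eₙ be the standard basis of the Euclidean space ℝⁿ. For 1 ≤ i ≤ n−1 let s_i be the linear isometry of ℝⁿ that interchanges e_i and e_{i+1} and fixes every other basis vector, and let sₙ be the linear isometry fixing e₁, …, e_{n−1} and sending eₙ to −eₙ. Let c₊ be the composition of the s_i with i odd and c₋ the composition of the s_i with i even (each composition is independent of the order of its factors, since those factors pairwise commute). Then c = c₋ ∘ c₊ has order 2n, and the set {e₁, −e₁, …, eₙ, −eₙ} is a single orbit, of size 2n, under the cyclic group generated by c. -/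
open EuclideanSpace

/-- The `2n` signed basis vectors `e₀, …, eₙ₋₁, -eₙ₋₁, …, -e₀`, listed in this order. -/
noncomputable def signedBasis (n p : ℕ) : EuclideanSpace ℝ (Fin n) :=
  if h : p < n then single ⟨p, h⟩ 1
  else if h : 2 * n - 1 - p < n then -single ⟨2 * n - 1 - p, h⟩ 1
  else 0

theorem signedBasis_val {n : ℕ} (j : Fin n) : signedBasis n j = single j 1 := by
  simp [signedBasis]

theorem signedBasis_reflect {n p : ℕ} (hp : p < 2 * n) :
    signedBasis n (2 * n - 1 - p) = -signedBasis n p := by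
  by_cases h : p < n
  · have h₁ : ¬ 2 * n - 1 - p < n := by omega
    have h₂ : 2 * n - 1 - (2 * n - 1 - p) = p := by omega
    simp [signedBasis, h, h₁, h₂]
  · have h₁ : 2 * n - 1 - p < n := by omega
    simp [signedBasis, h, h₁]

theorem signedBasis_eq_or {n p : ℕ} (hp : p < 2 * n) :
    ∃ j : Fin n, signedBasis n p = single j 1 ∨ signedBasis n p = -single j 1 := by
  by_cases h : p < n
  · exact ⟨⟨p, h⟩, Or.inl (signedBasis_val ⟨p, h⟩)⟩
  · refine ⟨⟨2 * n - 1 - p, by omega⟩, Or.inr ?_⟩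
    rw [← signedBasis_val, signedBasis_reflect hp, neg_neg]

theorem exists_signedBasis_eq {n : ℕ} {x : EuclideanSpace ℝ (Fin n)}
    (hx : ∃ j : Fin n, x = single j 1 ∨ x = -single j 1) :
    ∃ p < 2 * n, signedBasis n p = x := by
  obtain ⟨j, rfl | rfl⟩ := hx
  · exact ⟨j, by omega, signedBasis_val j⟩
  · exact ⟨2 * n - 1 - j, by omega, by rw [signedBasis_reflect (by omega), signedBasis_val]⟩

theorem signedBasis_injOn (n : ℕ) : Set.InjOn (signedBasis n) (Set.Iio (2 * n)) := by
  have hlt : ∀ i j : Fin n, (single i 1 : EuclideanSpace ℝ (Fin n)) = single j 1 → i = j := by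
    intro i j h
    by_contra hij
    simpa [hij] using congrArg (fun x : EuclideanSpace ℝ (Fin n) => x i) h
  have hne : ∀ i j : Fin n, (single i 1 : EuclideanSpace ℝ (Fin n)) ≠ -single j 1 := by
    intro i j h
    have h' := congrArg (fun x : EuclideanSpace ℝ (Fin n) => x i) h
    by_cases hij : i = j
    · subst hij
      norm_num at h'
    · simp [hij] at h'
  intro p hp q hq h
  simp only [Set.mem_Iio] at hp hq
  by_cases hpn : p < n <;> by_cases hqn : q < n
  · rw [signedBasis, signedBasis, dif_pos hpn, dif_pos hqn] at h
    simpa using hlt _ _ h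
  · have hq' : 2 * n - 1 - q < n := by omega
    rw [signedBasis, signedBasis, dif_pos hpn, dif_neg hqn, dif_pos hq'] at h
    exact absurd h (hne _ _)
  · have hp' : 2 * n - 1 - p < n := by omega
    rw [signedBasis, signedBasis, dif_neg hpn, dif_pos hp', dif_pos hqn] at h
    exact absurd h.symm (hne _ _)
  · have hp' : 2 * n - 1 - p < n := by omega
    have hq' : 2 * n - 1 - q < n := by omega
    rw [signedBasis, signedBasis, dif_neg hpn, dif_neg hqn, dif_pos hp', dif_pos hq'] at h
    have := hlt _ _ (neg_injective h)
    simp only [Fin.mk.injEq] at this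
    omega

section ListProd

variable {ι E : Type*} [NormedAddCommGroup E] [NormedSpace ℝ E] {s : ι → (E ≃ₗᵢ[ℝ] E)}

theorem list_prod_apply_eq_self {l : List ι} {x : E} (h : ∀ k ∈ l, s k x = x) :
    (l.map s).prod x = x := by
  induction l with
  | nil => simp
  | cons a l ih =>
    rw [List.map_cons, List.prod_cons, LinearIsometryEquiv.coe_mul, Function.comp_apply,
      ih fun k hk => h k (List.mem_cons_of_mem _ hk), h a List.mem_cons_self]

/-- If exactly one factor moves `x`, sending it to `y`, and the other factors fix `y`, then the
product sends `x` to `y`. -/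
theorem list_prod_apply_eq {l : List ι} (hl : l.Nodup) {k : ι} (hk : k ∈ l) {x y : E}
    (hxy : s k x = y) (hx : ∀ i ∈ l, i ≠ k → s i x = x) (hy : ∀ i ∈ l, i ≠ k → s i y = y) :
    (l.map s).prod x = y := by
  induction l with
  | nil => simp at hk
  | cons a l ih =>
    rw [List.nodup_cons] at hl
    rw [List.map_cons, List.prod_cons, LinearIsometryEquiv.coe_mul, Function.comp_apply]
    by_cases hak : a = k
    · subst hak
      rw [list_prod_apply_eq_self, hxy]
      intro i hi
      exact hx i (List.mem_cons_of_mem _ hi) fun h => hl.1 (h ▸ hi)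
    · have hk' : k ∈ l := by
        rcases List.mem_cons.1 hk with h | h
        · exact absurd h.symm hak
        · exact h
      rw [ih hl.2 hk' (fun i hi => hx i (List.mem_cons_of_mem _ hi))
        (fun i hi => hy i (List.mem_cons_of_mem _ hi)), hy a List.mem_cons_self hak]

end ListProd

section Reflections

variable {n : ℕ} {s : Fin n → (EuclideanSpace ℝ (Fin n) ≃ₗᵢ[ℝ] EuclideanSpace ℝ (Fin n))}

theorem map_signedBasis_reflect {f : EuclideanSpace ℝ (Fin n) ≃ₗᵢ[ℝ] EuclideanSpace ℝ (Fin n)}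
    {p q : ℕ} (hp : p < 2 * n) (hq : q < 2 * n) (h : f (signedBasis n p) = signedBasis n q) :
    f (signedBasis n (2 * n - 1 - p)) = signedBasis n (2 * n - 1 - q) := by
  rw [signedBasis_reflect hp, signedBasis_reflect hq, map_neg, h]

theorem reflection_signedBasis_of_ne
    (hfix : ∀ k : Fin n, ∀ p < n, p ≠ k → p ≠ k + 1 →
      s k (signedBasis n p) = signedBasis n p)
    (k : Fin n) {p : ℕ} (hp : p < 2 * n) (h₁ : p ≠ k) (h₂ : p ≠ k + 1)
    (h₃ : p ≠ 2 * n - 1 - k) (h₄ : p ≠ 2 * n - 2 - k) :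
    s k (signedBasis n p) = signedBasis n p := by
  by_cases hpn : p < n
  · exact hfix k p hpn h₁ h₂
  · have h := map_signedBasis_reflect (by omega) (by omega)
      (hfix k (2 * n - 1 - p) (by omega) (by omega) (by omega))
    rwa [show 2 * n - 1 - (2 * n - 1 - p) = p by omega] at h

/-- The product of the reflections with indices of parity `r` interchanges the signed basis
vectors at positions `p` and `p + 1` whenever `p` has parity `r`. -/
theorem parity_prod_signedBasis
    (hmove : ∀ k : Fin n, s k (signedBasis n k) = signedBasis n (k + 1) ∧
      s k (signedBasis n (k + 1)) = signedBasis n k)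
    (hfix : ∀ k : Fin n, ∀ p < n, p ≠ k → p ≠ k + 1 →
      s k (signedBasis n p) = signedBasis n p)
    {r p : ℕ} (hp : p + 1 < 2 * n) (hr : p % 2 = r) :
    (((List.finRange n).filter (fun k => k.val % 2 = r)).map s).prod (signedBasis n p)
        = signedBasis n (p + 1) ∧
      (((List.finRange n).filter (fun k => k.val % 2 = r)).map s).prod (signedBasis n (p + 1))
        = signedBasis n p := by
  obtain ⟨k, hk, h₁, h₂⟩ : ∃ k : Fin n, (p = k.val ∨ p = 2 * n - 2 - k) ∧
      s k (signedBasis n p) = signedBasis n (p + 1) ∧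
      s k (signedBasis n (p + 1)) = signedBasis n p := by
    by_cases hpn : p < n
    · exact ⟨⟨p, hpn⟩, Or.inl rfl, hmove ⟨p, hpn⟩⟩
    · have hkn : 2 * n - 2 - p < n := by omega
      have hm := hmove ⟨2 * n - 2 - p, hkn⟩
      have h₁ := map_signedBasis_reflect (by simp only; omega) (by simp only; omega) hm.1
      have h₂ := map_signedBasis_reflect (by simp only; omega) (by simp only; omega) hm.2
      simp only [show 2 * n - 1 - (2 * n - 2 - p) = p + 1 by omega,
        show 2 * n - 1 - (2 * n - 2 - p + 1) = p by omega] at h₁ h₂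
      exact ⟨⟨2 * n - 2 - p, hkn⟩, Or.inr (by simp only; omega), h₂, h₁⟩
  have hnodup := (List.nodup_finRange n).filter (fun k => decide (k.val % 2 = r))
  have hmem : k ∈ (List.finRange n).filter (fun k => decide (k.val % 2 = r)) := by
    simp only [List.mem_filter, List.mem_finRange, true_and, decide_eq_true_eq]
    omega
  have hother : ∀ i ∈ (List.finRange n).filter (fun k => decide (k.val % 2 = r)), i ≠ k →
      s i (signedBasis n p) = signedBasis n p ∧
      s i (signedBasis n (p + 1)) = signedBasis n (p + 1) := by
    intro i hi hik
    simp only [List.mem_filter, List.mem_finRange, true_and, decide_eq_true_eq] at hi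
    have hik' : i.val ≠ k.val := fun h => hik (Fin.ext h)
    constructor <;>
      exact reflection_signedBasis_of_ne hfix i (by omega) (by omega) (by omega) (by omega)
        (by omega)
  exact ⟨list_prod_apply_eq hnodup hmem h₁ (fun i hi hik => (hother i hi hik).1)
      fun i hi hik => (hother i hi hik).2,
    list_prod_apply_eq hnodup hmem h₂ (fun i hi hik => (hother i hi hik).2)
      fun i hi hik => (hother i hi hik).1⟩

theorem odd_prod_signedBasis_ends (hn : 0 < n)
    (hfix : ∀ k : Fin n, ∀ p < n, p ≠ k → p ≠ k + 1 →
      s k (signedBasis n p) = signedBasis n p)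
    {p : ℕ} (hp : p = 0 ∨ p = 2 * n - 1) :
    (((List.finRange n).filter (fun k => k.val % 2 = 1)).map s).prod (signedBasis n p)
      = signedBasis n p := by
  refine list_prod_apply_eq_self fun k hk => ?_
  simp only [List.mem_filter, List.mem_finRange, true_and, decide_eq_true_eq] at hk
  exact reflection_signedBasis_of_ne hfix k (by omega) (by omega) (by omega) (by omega) (by omega)

end Reflections

/-- The position reached from `0` after `m < 2n` steps of the cycle
`0, 2, …, 2n - 2, 2n - 1, 2n - 3, …, 1`. -/
def zigzag (n m : ℕ) : ℕ := if m < n then 2 * m else 4 * n - 1 - 2 * m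

theorem zigzag_lt {n m : ℕ} (hm : m < 2 * n) : zigzag n m < 2 * n := by
  unfold zigzag; split <;> omega

theorem exists_zigzag_eq {n p : ℕ} (hp : p < 2 * n) : ∃ m < 2 * n, zigzag n m = p := by
  unfold zigzag
  rcases Nat.mod_two_eq_zero_or_one p with h | h
  · exact ⟨p / 2, by omega, by split <;> omega⟩
  · exact ⟨(4 * n - 1 - p) / 2, by omega, by split <;> omega⟩


/-- **type `Bₙ`.** Let `s₁, …, sₙ` be the simple reflections of the Coxeter
group of type `Bₙ` acting on `ℝⁿ` (here `s k`, for `k : Fin n`, is `s_{k+1}` in 1-based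
indexing: for `k+1 < n` it interchanges `e_k` and `e_{k+1}` and fixes the other basis
vectors, and for `k = n-1` it negates `e_{n-1}` and fixes the rest).  Let `c₊` be the
product of the `s_j` with `j` odd (1-based) and `c₋` of those with `j` even.  Then the
bipartite Coxeter element `c = c₋ ∘ c₊` has order `2n`, and `{±e₁, …, ±eₙ}` is a single
orbit, of size `2n`, of the cyclic group generated by `c`. -/
theorem bipartite_coxeter_element_typeB_order_and_orbit
    (n : ℕ) (hn : 2 ≤ n)
    (s : Fin n → (EuclideanSpace ℝ (Fin n) ≃ₗᵢ[ℝ] EuclideanSpace ℝ (Fin n)))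
    (hswap : ∀ (k : Fin n) (hk : k.val + 1 < n),
      s k (EuclideanSpace.single k (1 : ℝ)) = EuclideanSpace.single ⟨k.val + 1, hk⟩ (1 : ℝ) ∧
      s k (EuclideanSpace.single ⟨k.val + 1, hk⟩ (1 : ℝ)) = EuclideanSpace.single k (1 : ℝ) ∧
      ∀ j : Fin n, j ≠ k → j.val ≠ k.val + 1 →
        s k (EuclideanSpace.single j (1 : ℝ)) = EuclideanSpace.single j (1 : ℝ))
    (hlast : ∀ k : Fin n, k.val = n - 1 →
      s k (EuclideanSpace.single k (1 : ℝ)) = -EuclideanSpace.single k (1 : ℝ) ∧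
      ∀ j : Fin n, j ≠ k →
        s k (EuclideanSpace.single j (1 : ℝ)) = EuclideanSpace.single j (1 : ℝ))
    (cplus cminus c : EuclideanSpace ℝ (Fin n) ≃ₗᵢ[ℝ] EuclideanSpace ℝ (Fin n))
    -- `s k` is `s_{k+1}` in 1-based indexing, so "`s_j` with `j` odd" means `k.val` even.
    (hcplus : cplus = (((List.finRange n).filter (fun k => k.val % 2 = 0)).map s).prod)
    (hcminus : cminus = (((List.finRange n).filter (fun k => k.val % 2 = 1)).map s).prod)
    (hc : c = cminus * cplus) :
    orderOf c = 2 * n ∧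
    (∀ x ∈ {x : EuclideanSpace ℝ (Fin n) | ∃ j : Fin n,
        x = EuclideanSpace.single j (1 : ℝ) ∨ x = -EuclideanSpace.single j (1 : ℝ)},
      c x ∈ {x : EuclideanSpace ℝ (Fin n) | ∃ j : Fin n,
        x = EuclideanSpace.single j (1 : ℝ) ∨ x = -EuclideanSpace.single j (1 : ℝ)}) ∧
    (∀ x ∈ {x : EuclideanSpace ℝ (Fin n) | ∃ j : Fin n,
        x = EuclideanSpace.single j (1 : ℝ) ∨ x = -EuclideanSpace.single j (1 : ℝ)},
     ∀ y ∈ {x : EuclideanSpace ℝ (Fin n) | ∃ j : Fin n,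
        x = EuclideanSpace.single j (1 : ℝ) ∨ x = -EuclideanSpace.single j (1 : ℝ)},
      ∃ m : ℤ, (c ^ m) x = y) ∧
    {x : EuclideanSpace ℝ (Fin n) | ∃ j : Fin n,
        x = EuclideanSpace.single j (1 : ℝ) ∨ x = -EuclideanSpace.single j (1 : ℝ)}.ncard
      = 2 * n := by
  have hmove : ∀ k : Fin n, s k (signedBasis n k) = signedBasis n (k + 1) ∧
      s k (signedBasis n (k + 1)) = signedBasis n k := by
    intro k
    by_cases hk : k.val + 1 < n
    · have hk' : signedBasis n (k + 1) = single ⟨k + 1, hk⟩ 1 := signedBasis_val ⟨k + 1, hk⟩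
      rw [signedBasis_val, hk']
      exact ⟨(hswap k hk).1, (hswap k hk).2.1⟩
    · have hk' : signedBasis n (k + 1) = -single k 1 := by
        rw [← signedBasis_val, ← signedBasis_reflect (by omega)]
        congr 1
        omega
      have h := (hlast k (by omega)).1
      rw [signedBasis_val, hk', map_neg, h, neg_neg]
      exact ⟨rfl, rfl⟩
  have hfix : ∀ k : Fin n, ∀ p < n, p ≠ k → p ≠ k + 1 →
      s k (signedBasis n p) = signedBasis n p := by
    intro k p hp h₁ h₂
    have hpk : (⟨p, hp⟩ : Fin n) ≠ k := fun h => h₁ (congrArg Fin.val h)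
    rw [show signedBasis n p = single ⟨p, hp⟩ 1 from signedBasis_val ⟨p, hp⟩]
    by_cases hk : k.val + 1 < n
    · exact (hswap k hk).2.2 ⟨p, hp⟩ hpk h₂
    · exact (hlast k (by omega)).2 ⟨p, hp⟩ hpk
  have hc_apply : ∀ x, c x = cminus (cplus x) := by
    intro x
    rw [hc, LinearIsometryEquiv.coe_mul, Function.comp_apply]
  have hplus : ∀ p, p + 1 < 2 * n → p % 2 = 0 →
      cplus (signedBasis n p) = signedBasis n (p + 1) ∧
      cplus (signedBasis n (p + 1)) = signedBasis n p := fun p hp hr => by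
    rw [hcplus]; exact parity_prod_signedBasis hmove hfix hp hr
  have hminus : ∀ p, p + 1 < 2 * n → p % 2 = 1 →
      cminus (signedBasis n p) = signedBasis n (p + 1) ∧
      cminus (signedBasis n (p + 1)) = signedBasis n p := fun p hp hr => by
    rw [hcminus]; exact parity_prod_signedBasis hmove hfix hp hr
  have hends : ∀ p, p = 0 ∨ p = 2 * n - 1 → cminus (signedBasis n p) = signedBasis n p :=
    fun p hp => by rw [hcminus]; exact odd_prod_signedBasis_ends (by omega) hfix hp
  have hup : ∀ p, p % 2 = 0 → p + 2 < 2 * n →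
      c (signedBasis n p) = signedBasis n (p + 2) := fun p hr hp => by
    rw [hc_apply, (hplus p (by omega) hr).1, (hminus (p + 1) (by omega) (by omega)).1]
  have htop : c (signedBasis n (2 * n - 2)) = signedBasis n (2 * n - 1) := by
    rw [hc_apply, (hplus _ (by omega) (by omega)).1, hends _ (Or.inr (by omega))]
    congr 1
    omega
  have hdown : ∀ p, p % 2 = 1 → p + 2 < 2 * n →
      c (signedBasis n (p + 2)) = signedBasis n p := fun p hr hp => by
    rw [hc_apply, (hplus (p + 1) (by omega) (by omega)).2, (hminus p (by omega) hr).2]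
  have hbot : c (signedBasis n 1) = signedBasis n 0 := by
    rw [hc_apply, (hplus 0 (by omega) rfl).2, hends 0 (Or.inl rfl)]
  have hstep : ∀ m, m + 1 < 2 * n →
      c (signedBasis n (zigzag n m)) = signedBasis n (zigzag n (m + 1)) := by
    intro m hm
    unfold zigzag
    rcases lt_trichotomy (m + 1) n with h | h | h
    · rw [if_pos (by omega), if_pos h, hup _ (by omega) (by omega)]
      rfl
    · rw [if_pos (by omega), if_neg (by omega), show 2 * m = 2 * n - 2 by omega, htop]
      congr 1
      omega
    · rw [if_neg (by omega), if_neg (by omega),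
        show 4 * n - 1 - 2 * m = 4 * n - 1 - 2 * (m + 1) + 2 by omega,
        hdown _ (by omega) (by omega)]
  have hpow : ∀ m < 2 * n, (c ^ m) (signedBasis n 0) = signedBasis n (zigzag n m) := by
    intro m
    induction m with
    | zero =>
      intro _
      simp [zigzag, show 0 < n by omega]
    | succ m ih =>
      intro hm
      rw [pow_succ', LinearIsometryEquiv.coe_mul, Function.comp_apply, ih (by omega), hstep m hm]
  have hreach : ∀ p < 2 * n, ∃ m < 2 * n, (c ^ m) (signedBasis n 0) = signedBasis n p := by
    intro p hp
    obtain ⟨m, hm, rfl⟩ := exists_zigzag_eq hp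
    exact ⟨m, hm, hpow m hm⟩
  have hperiod : (c ^ (2 * n)) (signedBasis n 0) = signedBasis n 0 := by
    rw [show 2 * n = 2 * n - 1 + 1 by omega, pow_succ', LinearIsometryEquiv.coe_mul,
      Function.comp_apply, hpow _ (by omega), zigzag, if_neg (by omega),
      show 4 * n - 1 - 2 * (2 * n - 1) = 1 by omega, hbot]
  have hone : c ^ (2 * n) = 1 := by
    refine LinearIsometryEquiv.toLinearEquiv_injective (LinearEquiv.toLinearMap_injective
      ((EuclideanSpace.basisFun (Fin n) ℝ).toBasis.ext fun j => ?_))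
    obtain ⟨m, -, hm⟩ := hreach j (by omega)
    have h : (c ^ (2 * n)) (signedBasis n j) = signedBasis n j := by
      rw [← hm, ← Function.comp_apply (f := ⇑(c ^ (2 * n))), ← LinearIsometryEquiv.coe_mul,
        ← pow_add, add_comm, pow_add, LinearIsometryEquiv.coe_mul, Function.comp_apply, hperiod]
    rw [signedBasis_val] at h
    simpa using h
  refine ⟨(orderOf_eq_iff (by omega)).2 ⟨hone, fun m hm hpos h => ?_⟩, ?_, ?_, ?_⟩
  · have h' := hpow m hm
    rw [h, LinearIsometryEquiv.coe_one, id_eq] at h'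
    have h₀ := signedBasis_injOn n (by simp only [Set.mem_Iio]; omega) (zigzag_lt hm) h'
    unfold zigzag at h₀
    split at h₀ <;> omega
  · intro x hx
    obtain ⟨p, hp, rfl⟩ := exists_signedBasis_eq hx
    obtain ⟨m, hm, rfl⟩ := exists_zigzag_eq hp
    by_cases hm' : m + 1 < 2 * n
    · rw [hstep m hm']
      exact signedBasis_eq_or (zigzag_lt hm')
    · rw [← hpow m hm, ← Function.comp_apply (f := ⇑c), ← LinearIsometryEquiv.coe_mul,
        ← pow_succ', show m + 1 = 2 * n by omega, hperiod]
      exact signedBasis_eq_or (by omega)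
  · intro x hx y hy
    obtain ⟨p, hp, rfl⟩ := exists_signedBasis_eq hx
    obtain ⟨q, hq, rfl⟩ := exists_signedBasis_eq hy
    obtain ⟨a, -, ha⟩ := hreach p hp
    obtain ⟨b, -, hb⟩ := hreach q hq
    refine ⟨(b : ℤ) - a, ?_⟩
    rw [← ha, ← hb, ← Function.comp_apply (f := ⇑(c ^ ((b : ℤ) - a))),
      ← LinearIsometryEquiv.coe_mul, ← zpow_natCast c a, ← zpow_add, sub_add_cancel,
      zpow_natCast]
  · have himage : {x : EuclideanSpace ℝ (Fin n) | ∃ j : Fin n,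
        x = single j (1 : ℝ) ∨ x = -single j (1 : ℝ)} = signedBasis n '' Set.Iio (2 * n) := by
      ext x
      constructor
      · exact exists_signedBasis_eq
      · rintro ⟨p, hp, rfl⟩
        exact signedBasis_eq_or hp
    rw [himage, (signedBasis_injOn n).ncard_image, ← Finset.coe_Iio, Set.ncard_coe_finset,
      Nat.card_Iio]
end

section
/- Let n ≥ 4 and let e₁, …, eₙ be the standard basis of the Euclidean space ℝⁿ. For 1 ≤ i ≤ n−1 let s_i be the linear isometry of ℝⁿ that interchanges e_i and e_{i+1} and fixes every other basis vector, and let sₙ be the linear isometry sending e_{n−1} to −eₙ and eₙ to −e_{n−1} and fixing every other basis vector. Partition {s₁, …, sₙ} by placing s_i (for i ≤ n−1) in S₊ if i is odd and in S₋ if i is even, and placing sₙ in the same part as s_{n−1}. Let c₊ be the composition of the elements of S₊ and c₋ the composition of the elements of S₋ (each composition is independent of the order of its factors, since those factors pairwise commute), and let c = c₋ ∘ c₊. Then: (1) c(eₙ) = −eₙ, so {eₙ, −eₙ} is an orbit of the cyclic group generated by c; (2) the set {e₁, −e₁, …, e_{n−1}, −e_{n−1}} is a single orbit, of size 2n−2,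 under the cyclic group generated by c; and (3) c has order 2n−2. -/
noncomputable section

namespace TypeD

/-- The standard basis vector `e_j` of `ℝⁿ`, extended by zero to all `j : ℕ`. -/
def stdVec (n j : ℕ) : EuclideanSpace ℝ (Fin n) :=
  if h : j < n then EuclideanSpace.single ⟨j, h⟩ 1 else 0

/-- The sequence `e_0, …, e_{n-2}, -e_{n-2}, …, -e_0`, on which the two halves of the bipartite
Coxeter element act by exchanging neighbours. -/
def pathVec (n p : ℕ) : EuclideanSpace ℝ (Fin n) :=
  if p < n - 1 then stdVec n p else -stdVec n (2 * n - 3 - p)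

/-- The vectors `±e_0, …, ±e_{n-2}` in the cyclic order in which the bipartite Coxeter element
permutes them: first the even positions of `pathVec` upwards, then the odd ones downwards. -/
def cycleVec (n t : ℕ) : EuclideanSpace ℝ (Fin n) :=
  pathVec n (if t < n - 1 then 2 * t else 4 * n - 5 - 2 * t)

/-- The set `{±e_0, …, ±e_{n-2}}`. -/
def signedVecs (n : ℕ) : Set (EuclideanSpace ℝ (Fin n)) :=
  {x | ∃ j : Fin n, j.val < n - 1 ∧
    (x = EuclideanSpace.single j (1 : ℝ) ∨ x = -EuclideanSpace.single j (1 : ℝ))}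

theorem isometryEquiv_mul_apply {V : Type*} [NormedAddCommGroup V] [NormedSpace ℝ V]
    (f g : V ≃ₗᵢ[ℝ] V) (x : V) : (f * g) x = f (g x) := rfl

theorem stdVec_of_lt {n j : ℕ} (h : j < n) :
    stdVec n j = EuclideanSpace.single ⟨j, h⟩ 1 := dif_pos h

theorem stdVec_val {n : ℕ} (j : Fin n) : stdVec n j = EuclideanSpace.single j 1 :=
  stdVec_of_lt j.isLt

theorem stdVec_inj {n i j : ℕ} (hi : i < n) (h : stdVec n i = stdVec n j) : i = j := by
  by_contra hij
  have := congrArg (fun x => x ⟨i, hi⟩) h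
  by_cases hj : j < n <;> simp [stdVec, hi, hj, hij] at this

theorem stdVec_ne_neg {n i j : ℕ} (hi : i < n) : stdVec n i ≠ -stdVec n j := by
  intro h
  have := congrArg (fun x => x ⟨i, hi⟩) h
  by_cases hj : j < n
  · by_cases hij : i = j
    · subst hij
      simp [stdVec, hi] at this
      norm_num at this
    · simp [stdVec, hi, hj, hij] at this
  · simp [stdVec, hi, hj] at this

theorem pathVec_injOn (n : ℕ) : Set.InjOn (pathVec n) (Set.Iio (2 * n - 2)) := by
  intro p hp q hq h
  simp only [Set.mem_Iio] at hp hq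
  unfold pathVec at h
  split_ifs at h with h₁ h₂ h₂
  · exact stdVec_inj (by omega) h
  · exact absurd h (stdVec_ne_neg (by omega))
  · exact absurd h.symm (stdVec_ne_neg (by omega))
  · have := stdVec_inj (by omega) (neg_injective h)
    omega

theorem image_pathVec (n : ℕ) : pathVec n '' Set.Iio (2 * n - 2) = signedVecs n := by
  ext x
  constructor
  · rintro ⟨p, hp, rfl⟩
    simp only [Set.mem_Iio] at hp
    unfold pathVec
    split_ifs with h
    · exact ⟨⟨p, by omega⟩, h, Or.inl (stdVec_of_lt _)⟩
    · exact ⟨⟨2 * n - 3 - p, by omega⟩, by simp only; omega,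
        Or.inr (congrArg _ (stdVec_of_lt _))⟩
  · rintro ⟨j, hj, rfl | rfl⟩
    · exact ⟨j, by simp only [Set.mem_Iio]; omega, by rw [pathVec, if_pos hj, stdVec_val]⟩
    · refine ⟨2 * n - 3 - j, by simp only [Set.mem_Iio]; omega, ?_⟩
      rw [pathVec, if_neg (by omega), show 2 * n - 3 - (2 * n - 3 - j.val) = j by omega,
        stdVec_val]

theorem ncard_signedVecs (n : ℕ) : (signedVecs n).ncard = 2 * n - 2 := by
  rw [← image_pathVec, (pathVec_injOn n).ncard_image, ← Finset.coe_Iio, Set.ncard_coe_finset,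
    Nat.card_Iio]

theorem cycleVec_mem {n t : ℕ} (ht : t < 2 * n - 2) : cycleVec n t ∈ signedVecs n := by
  rw [← image_pathVec]
  refine ⟨_, ?_, rfl⟩
  simp only [Set.mem_Iio]
  split_ifs <;> omega

theorem exists_cycleVec {n : ℕ} {x : EuclideanSpace ℝ (Fin n)} (hx : x ∈ signedVecs n) :
    ∃ t < 2 * n - 2, cycleVec n t = x := by
  rw [← image_pathVec] at hx
  obtain ⟨p, hp, rfl⟩ := hx
  simp only [Set.mem_Iio] at hp
  obtain h | h := Nat.mod_two_eq_zero_or_one p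
  · refine ⟨p / 2, by omega, ?_⟩
    rw [cycleVec, if_pos (by omega)]
    congr 1
    omega
  · refine ⟨(4 * n - 5 - p) / 2, by omega, ?_⟩
    rw [cycleVec, if_neg (by omega)]
    congr 1
    omega

theorem cycleVec_ne_zero_index {n t : ℕ} (h₀ : 0 < t) (ht : t < 2 * n - 2) :
    cycleVec n t ≠ cycleVec n 0 := by
  intro h
  have := pathVec_injOn n
    (by simp only [Set.mem_Iio]; split_ifs <;> omega)
    (by simp only [Set.mem_Iio]; split_ifs <;> omega) h
  split_ifs at this <;> omega

section ListProd

variable {ι V : Type*} [NormedAddCommGroup V] [NormedSpace ℝ V] {s : ι → (V ≃ₗᵢ[ℝ] V)}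

theorem prod_map_apply_of_fixed {l : List ι} {x : V} (h : ∀ k ∈ l, s k x = x) :
    (l.map s).prod x = x := by
  induction l with
  | nil => rfl
  | cons k l ih =>
    rw [List.map_cons, List.prod_cons, isometryEquiv_mul_apply,
      ih fun i hi => h i (List.mem_cons_of_mem _ hi), h k List.mem_cons_self]

theorem prod_map_apply_of_mem {l : List ι} (hl : l.Nodup) {a : ι} (ha : a ∈ l) {x y : V}
    (hxy : s a x = y) (h : ∀ k ∈ l, k ≠ a → s k x = x ∧ s k y = y) :
    (l.map s).prod x = y := by
  induction l with
  | nil => simp at ha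
  | cons k l ih =>
    rw [List.nodup_cons] at hl
    rw [List.map_cons, List.prod_cons, isometryEquiv_mul_apply]
    by_cases hk : k = a
    · subst hk
      rw [prod_map_apply_of_fixed fun i hi => (h i (List.mem_cons_of_mem _ hi) ?_).1, hxy]
      rintro rfl
      exact hl.1 hi
    · rw [ih hl.2 ((List.mem_cons.1 ha).resolve_left (Ne.symm hk))
        fun i hi => h i (List.mem_cons_of_mem _ hi)]
      exact (h k List.mem_cons_self hk).2

theorem prod_map_apply_of_mem_of_mem {l : List ι} (hl : l.Nodup) {a b : ι} (hab : a ≠ b)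
    (ha : a ∈ l) (hb : b ∈ l) {x y y' z : V}
    (hxy : s a x = y) (hyz : s b y = z) (hxy' : s b x = y') (hyz' : s a y' = z)
    (h : ∀ k ∈ l, k ≠ a → k ≠ b → s k x = x ∧ s k y = y ∧ s k y' = y' ∧ s k z = z) :
    (l.map s).prod x = z := by
  induction l with
  | nil => simp at ha
  | cons k l ih =>
    rw [List.nodup_cons] at hl
    rw [List.map_cons, List.prod_cons, isometryEquiv_mul_apply]
    by_cases hka : k = a
    · subst hka
      rw [prod_map_apply_of_mem hl.2 ((List.mem_cons.1 hb).resolve_left hab.symm) hxy', hyz']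
      intro i hi hib
      have := h i (List.mem_cons_of_mem _ hi) (by rintro rfl; exact hl.1 hi) hib
      exact ⟨this.1, this.2.2.1⟩
    by_cases hkb : k = b
    · subst hkb
      rw [prod_map_apply_of_mem hl.2 ((List.mem_cons.1 ha).resolve_left hab) hxy, hyz]
      intro i hi hia
      have := h i (List.mem_cons_of_mem _ hi) hia (by rintro rfl; exact hl.1 hi)
      exact ⟨this.1, this.2.1⟩
    rw [ih hl.2 ((List.mem_cons.1 ha).resolve_left (Ne.symm hka))
      ((List.mem_cons.1 hb).resolve_left (Ne.symm hkb))
      fun i hi => h i (List.mem_cons_of_mem _ hi)]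
    exact (h k List.mem_cons_self hka hkb).2.2.2

end ListProd

/-- The maps `s k` act on the standard basis as the simple reflections of type `Dₙ`. -/
structure IsSimpleSystem (n : ℕ)
    (s : Fin n → (EuclideanSpace ℝ (Fin n) ≃ₗᵢ[ℝ] EuclideanSpace ℝ (Fin n))) : Prop where
  swap_left : ∀ k : Fin n, k.val + 1 < n → s k (stdVec n k) = stdVec n (k + 1)
  swap_right : ∀ k : Fin n, k.val + 1 < n → s k (stdVec n (k + 1)) = stdVec n k
  fixed : ∀ k : Fin n, k.val + 1 < n → ∀ j, j ≠ k.val → j ≠ k.val + 1 →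
    s k (stdVec n j) = stdVec n j
  last_left : ∀ k : Fin n, k.val = n - 1 → s k (stdVec n (n - 2)) = -stdVec n (n - 1)
  last_right : ∀ k : Fin n, k.val = n - 1 → s k (stdVec n (n - 1)) = -stdVec n (n - 2)
  last_fixed : ∀ k : Fin n, k.val = n - 1 → ∀ j, j ≠ n - 1 → j ≠ n - 2 →
    s k (stdVec n j) = stdVec n j

/-- The indices in the part of the bipartition containing the `k ≤ n - 2` of parity `r`. -/
def part (n r : ℕ) : List (Fin n) :=
  (List.finRange n).filter (fun k => if k.val = n - 1 then n % 2 = r else k.val % 2 = r)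

theorem part_nodup (n r : ℕ) : (part n r).Nodup := (List.nodup_finRange n).filter _

theorem mem_part {n r : ℕ} {k : Fin n} :
    k ∈ part n r ↔ if k.val = n - 1 then n % 2 = r else k.val % 2 = r := by
  simp [part]

namespace IsSimpleSystem

variable {n r : ℕ} {s : Fin n → (EuclideanSpace ℝ (Fin n) ≃ₗᵢ[ℝ] EuclideanSpace ℝ (Fin n))}

theorem apply_stdVec_of_ne (hs : IsSimpleSystem n s) (k : Fin n) {j : ℕ} (h₀ : j ≠ k.val)
    (h₁ : j ≠ k.val + 1) (h₂ : k.val = n - 1 → j ≠ n - 2) : s k (stdVec n j) = stdVec n j := by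
  by_cases hk : k.val + 1 < n
  · exact hs.fixed k hk j h₀ h₁
  · exact hs.last_fixed k (by omega) j (by omega) (h₂ (by omega))

theorem part_apply_left (hs : IsSimpleSystem n s) {j : ℕ} (hj : j + 2 < n) (hr : j % 2 = r) :
    ((part n r).map s).prod (stdVec n j) = stdVec n (j + 1) := by
  refine prod_map_apply_of_mem (part_nodup n r) (a := ⟨j, by omega⟩)
    (mem_part.2 (by rw [if_neg (by simp only; omega)]; exact hr))
    (hs.swap_left ⟨j, by omega⟩ (by simp only; omega)) fun k hk hkj => ?_
  rw [mem_part] at hk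
  rw [Ne, Fin.ext_iff] at hkj
  simp only at hkj
  constructor <;> apply hs.apply_stdVec_of_ne <;> split_ifs at hk <;> omega

theorem part_apply_right (hs : IsSimpleSystem n s) {j : ℕ} (hj : j + 2 < n) (hr : j % 2 = r) :
    ((part n r).map s).prod (stdVec n (j + 1)) = stdVec n j := by
  refine prod_map_apply_of_mem (part_nodup n r) (a := ⟨j, by omega⟩)
    (mem_part.2 (by rw [if_neg (by simp only; omega)]; exact hr))
    (hs.swap_right ⟨j, by omega⟩ (by simp only; omega)) fun k hk hkj => ?_
  rw [mem_part] at hk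
  rw [Ne, Fin.ext_iff] at hkj
  simp only at hkj
  constructor <;> apply hs.apply_stdVec_of_ne <;> split_ifs at hk <;> omega

theorem part_apply_penultimate (hs : IsSimpleSystem n s) (hn : 4 ≤ n) (hr : n % 2 = r) :
    ((part n r).map s).prod (stdVec n (n - 2)) = -stdVec n (n - 2) := by
  have h₁ : n - 2 + 1 = n - 1 := by omega
  have hl := hs.swap_left ⟨n - 2, by omega⟩ (by simp only; omega)
  have hr' := hs.swap_right ⟨n - 2, by omega⟩ (by simp only; omega)
  simp only [h₁] at hl hr'
  refine prod_map_apply_of_mem_of_mem (part_nodup n r) (a := ⟨n - 2, by omega⟩)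
    (b := ⟨n - 1, by omega⟩) (by rw [Ne, Fin.ext_iff]; simp only; omega)
    (mem_part.2 (by rw [if_neg (by simp only; omega)]; simp only; omega))
    (mem_part.2 (by rw [if_pos rfl]; exact hr))
    hl (hs.last_right _ rfl) (hs.last_left _ rfl) (by rw [map_neg, hr']) fun k hk hka hkb => ?_
  rw [mem_part] at hk
  rw [Ne, Fin.ext_iff] at hka hkb
  simp only at hka hkb
  rw [if_neg hkb] at hk
  rw [map_neg, map_neg, hs.apply_stdVec_of_ne k (by omega) (by omega) (by omega),
    hs.apply_stdVec_of_ne k (by omega) (by omega) (by omega)]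
  simp

theorem part_apply_last (hs : IsSimpleSystem n s) (hn : 4 ≤ n) (hr : n % 2 = r) :
    ((part n r).map s).prod (stdVec n (n - 1)) = -stdVec n (n - 1) := by
  have h₁ : n - 2 + 1 = n - 1 := by omega
  have hl := hs.swap_left ⟨n - 2, by omega⟩ (by simp only; omega)
  have hr' := hs.swap_right ⟨n - 2, by omega⟩ (by simp only; omega)
  simp only [h₁] at hl hr'
  refine prod_map_apply_of_mem_of_mem (part_nodup n r) (a := ⟨n - 2, by omega⟩)
    (b := ⟨n - 1, by omega⟩) (by rw [Ne, Fin.ext_iff]; simp only; omega)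
    (mem_part.2 (by rw [if_neg (by simp only; omega)]; simp only; omega))
    (mem_part.2 (by rw [if_pos rfl]; exact hr))
    hr' (hs.last_left _ rfl) (hs.last_right _ rfl) (by rw [map_neg, hl]) fun k hk hka hkb => ?_
  rw [mem_part] at hk
  rw [Ne, Fin.ext_iff] at hka hkb
  simp only at hka hkb
  rw [if_neg hkb] at hk
  rw [map_neg, map_neg, hs.apply_stdVec_of_ne k (by omega) (by omega) (by omega),
    hs.apply_stdVec_of_ne k (by omega) (by omega) (by omega)]
  simp

theorem part_apply_last_of_ne (hs : IsSimpleSystem n s) (hn : 4 ≤ n) (hr : n % 2 ≠ r)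
    (hr₂ : r < 2) :
    ((part n r).map s).prod (stdVec n (n - 1)) = stdVec n (n - 1) := by
  refine prod_map_apply_of_fixed fun k hk => ?_
  rw [mem_part] at hk
  apply hs.apply_stdVec_of_ne <;> split_ifs at hk <;> omega

theorem part_one_apply_zero (hs : IsSimpleSystem n s) (hn : 4 ≤ n) :
    ((part n 1).map s).prod (stdVec n 0) = stdVec n 0 := by
  refine prod_map_apply_of_fixed fun k hk => ?_
  rw [mem_part] at hk
  apply hs.apply_stdVec_of_ne <;> split_ifs at hk <;> omega

theorem part_apply_pathVec (hs : IsSimpleSystem n s) (hn : 4 ≤ n) {p : ℕ}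
    (hp : p + 1 < 2 * n - 2) (hr : p % 2 = r) :
    ((part n r).map s).prod (pathVec n p) = pathVec n (p + 1) := by
  obtain h | h | h := lt_trichotomy (p + 1) (n - 1)
  · rw [pathVec, pathVec, if_pos (by omega), if_pos h, hs.part_apply_left (by omega) hr]
  · rw [pathVec, pathVec, if_pos (by omega), if_neg (by omega), show p = n - 2 by omega,
      show 2 * n - 3 - (n - 2 + 1) = n - 2 by omega, hs.part_apply_penultimate hn (by omega)]
  · rw [pathVec, pathVec, if_neg (by omega), if_neg (by omega), map_neg,
      show 2 * n - 3 - p = 2 * n - 3 - (p + 1) + 1 by omega,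
      hs.part_apply_right (by omega) (by omega)]

theorem part_apply_pathVec_succ (hs : IsSimpleSystem n s) (hn : 4 ≤ n) {p : ℕ}
    (hp : p + 1 < 2 * n - 2) (hr : p % 2 = r) :
    ((part n r).map s).prod (pathVec n (p + 1)) = pathVec n p := by
  obtain h | h | h := lt_trichotomy (p + 1) (n - 1)
  · rw [pathVec, pathVec, if_pos (by omega), if_pos (by omega), hs.part_apply_right (by omega) hr]
  · rw [pathVec, pathVec, if_neg (by omega), if_pos (by omega), show p = n - 2 by omega,
      show 2 * n - 3 - (n - 2 + 1) = n - 2 by omega, map_neg,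
      hs.part_apply_penultimate hn (by omega), neg_neg]
  · rw [pathVec, pathVec, if_neg (by omega), if_neg (by omega), map_neg,
      show 2 * n - 3 - p = 2 * n - 3 - (p + 1) + 1 by omega,
      hs.part_apply_left (by omega) (by omega)]

/-- The bipartite Coxeter element. -/
def _root_.TypeD.coxeter
    (s : Fin n → (EuclideanSpace ℝ (Fin n) ≃ₗᵢ[ℝ] EuclideanSpace ℝ (Fin n))) :
    EuclideanSpace ℝ (Fin n) ≃ₗᵢ[ℝ] EuclideanSpace ℝ (Fin n) :=
  ((part n 1).map s).prod * ((part n 0).map s).prod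

theorem coxeter_apply_last (hs : IsSimpleSystem n s) (hn : 4 ≤ n) :
    coxeter s (stdVec n (n - 1)) = -stdVec n (n - 1) := by
  rw [coxeter, isometryEquiv_mul_apply]
  obtain h | h := Nat.mod_two_eq_zero_or_one n
  · rw [hs.part_apply_last hn h, map_neg, hs.part_apply_last_of_ne hn (by omega) (by omega)]
  · rw [hs.part_apply_last_of_ne hn (by omega) (by omega), hs.part_apply_last hn h]

theorem coxeter_apply_cycleVec (hs : IsSimpleSystem n s) (hn : 4 ≤ n) {t : ℕ}
    (ht : t + 1 < 2 * n - 2) : coxeter s (cycleVec n t) = cycleVec n (t + 1) := by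
  rw [coxeter, isometryEquiv_mul_apply]
  obtain h | h | h := lt_trichotomy (t + 1) (n - 1)
  · rw [cycleVec, cycleVec, if_pos (by omega), if_pos h,
      hs.part_apply_pathVec hn (by omega) (by omega),
      hs.part_apply_pathVec hn (by omega) (by omega)]
    rfl
  · rw [cycleVec, cycleVec, if_pos (by omega), if_neg (by omega),
      hs.part_apply_pathVec hn (by omega) (by omega),
      show 4 * n - 5 - 2 * (t + 1) = 2 * t + 1 by omega, pathVec, if_neg (by omega), map_neg,
      show 2 * n - 3 - (2 * t + 1) = 0 by omega, hs.part_one_apply_zero hn]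
  · rw [cycleVec, cycleVec, if_neg (by omega), if_neg (by omega),
      show 4 * n - 5 - 2 * t = 4 * n - 5 - 2 * (t + 1) + 1 + 1 by omega,
      hs.part_apply_pathVec_succ hn (by omega) (by omega),
      hs.part_apply_pathVec_succ hn (by omega) (by omega)]

theorem coxeter_apply_cycleVec_last (hs : IsSimpleSystem n s) (hn : 4 ≤ n) :
    coxeter s (cycleVec n (2 * n - 3)) = cycleVec n 0 := by
  rw [coxeter, isometryEquiv_mul_apply, cycleVec, cycleVec, if_neg (by omega),
    if_pos (by omega), show 4 * n - 5 - 2 * (2 * n - 3) = 0 + 1 by omega,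
    hs.part_apply_pathVec_succ hn (by omega) (by omega), pathVec, if_pos (by omega),
    hs.part_one_apply_zero hn]

theorem coxeter_pow_apply_cycleVec (hs : IsSimpleSystem n s) (hn : 4 ≤ n) {t : ℕ}
    (ht : t < 2 * n - 2) : (coxeter s ^ t) (cycleVec n 0) = cycleVec n t := by
  induction t with
  | zero => rfl
  | succ t ih =>
    rw [pow_succ', isometryEquiv_mul_apply, ih (by omega),
      hs.coxeter_apply_cycleVec hn ht]

theorem coxeter_pow_apply_cycleVec_zero (hs : IsSimpleSystem n s) (hn : 4 ≤ n) :
    (coxeter s ^ (2 * n - 2)) (cycleVec n 0) = cycleVec n 0 := by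
  rw [show 2 * n - 2 = 2 * n - 3 + 1 by omega, pow_succ', isometryEquiv_mul_apply,
    hs.coxeter_pow_apply_cycleVec hn (by omega), hs.coxeter_apply_cycleVec_last hn]

theorem coxeter_apply_mem (hs : IsSimpleSystem n s) (hn : 4 ≤ n)
    {x : EuclideanSpace ℝ (Fin n)} (hx : x ∈ signedVecs n) : coxeter s x ∈ signedVecs n := by
  obtain ⟨t, ht, rfl⟩ := exists_cycleVec hx
  by_cases h : t + 1 < 2 * n - 2
  · rw [hs.coxeter_apply_cycleVec hn h]
    exact cycleVec_mem h
  · rw [show t = 2 * n - 3 by omega, hs.coxeter_apply_cycleVec_last hn]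
    exact cycleVec_mem (by omega)

theorem exists_coxeter_zpow_apply_eq (hs : IsSimpleSystem n s) (hn : 4 ≤ n)
    {x y : EuclideanSpace ℝ (Fin n)} (hx : x ∈ signedVecs n) (hy : y ∈ signedVecs n) :
    ∃ m : ℤ, (coxeter s ^ m) x = y := by
  obtain ⟨a, ha, rfl⟩ := exists_cycleVec hx
  obtain ⟨b, hb, rfl⟩ := exists_cycleVec hy
  refine ⟨b - a, ?_⟩
  rw [← hs.coxeter_pow_apply_cycleVec hn ha, ← hs.coxeter_pow_apply_cycleVec hn hb,
    ← isometryEquiv_mul_apply, ← zpow_natCast, ← zpow_add, sub_add_cancel, zpow_natCast]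

theorem coxeter_pow_apply_of_mem (hs : IsSimpleSystem n s) (hn : 4 ≤ n)
    {x : EuclideanSpace ℝ (Fin n)} (hx : x ∈ signedVecs n) :
    (coxeter s ^ (2 * n - 2)) x = x := by
  obtain ⟨t, ht, rfl⟩ := exists_cycleVec hx
  rw [← hs.coxeter_pow_apply_cycleVec hn ht, ← isometryEquiv_mul_apply, ← pow_add,
    add_comm, pow_add, isometryEquiv_mul_apply, hs.coxeter_pow_apply_cycleVec_zero hn]

theorem coxeter_pow_apply_last (hs : IsSimpleSystem n s) (hn : 4 ≤ n) :
    (coxeter s ^ (2 * n - 2)) (stdVec n (n - 1)) = stdVec n (n - 1) := by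
  have h (m : ℕ) : (coxeter s ^ (2 * m)) (stdVec n (n - 1)) = stdVec n (n - 1) := by
    induction m with
    | zero => rfl
    | succ m ih =>
      rw [show 2 * (m + 1) = 2 * m + 1 + 1 by ring, pow_succ, pow_succ,
        isometryEquiv_mul_apply, isometryEquiv_mul_apply, hs.coxeter_apply_last hn,
        map_neg, hs.coxeter_apply_last hn, neg_neg, ih]
  rw [show 2 * n - 2 = 2 * (n - 1) by omega, h]

theorem coxeter_pow_eq_one (hs : IsSimpleSystem n s) (hn : 4 ≤ n) :
    coxeter s ^ (2 * n - 2) = 1 := by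
  apply LinearIsometryEquiv.toLinearEquiv_injective
  refine (EuclideanSpace.basisFun (Fin n) ℝ).toBasis.ext' fun j => ?_
  rw [OrthonormalBasis.coe_toBasis, EuclideanSpace.basisFun_apply]
  change (coxeter s ^ (2 * n - 2)) (EuclideanSpace.single j 1) = EuclideanSpace.single j 1
  by_cases hj : j.val < n - 1
  · exact hs.coxeter_pow_apply_of_mem hn ⟨j, hj, Or.inl rfl⟩
  · rw [← stdVec_val, show j.val = n - 1 by omega, hs.coxeter_pow_apply_last hn]

theorem orderOf_coxeter (hs : IsSimpleSystem n s) (hn : 4 ≤ n) :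
    orderOf (coxeter s) = 2 * n - 2 := by
  refine (orderOf_eq_iff (by omega)).2 ⟨hs.coxeter_pow_eq_one hn, fun m hm h₀ h => ?_⟩
  refine cycleVec_ne_zero_index h₀ hm ?_
  rw [← hs.coxeter_pow_apply_cycleVec hn hm, h]
  rfl

end IsSimpleSystem

end TypeD

end

/-- **type `Dₙ`.** Let `s₁, …, sₙ` be the simple reflections of the Coxeter
group of type `Dₙ` acting on `ℝⁿ` (here `s k`, for `k : Fin n`, is `s_{k+1}` in 1-based
indexing: for `k+1 < n` it interchanges `e_k` and `e_{k+1}` and fixes the other basis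
vectors, and for `k = n-1` it sends `e_{n-2} ↦ -e_{n-1}` and `e_{n-1} ↦ -e_{n-2}` and fixes
the rest).  Bipartition the generators, with the last generator in the same part as the
next-to-last, and let `c = c₋ ∘ c₊` be the bipartite Coxeter element.  Then
`c(eₙ) = -eₙ` (so `{eₙ, -eₙ}` is a `⟨c⟩`-orbit), the set `{±e₁, …, ±e_{n-1}}` is a single
`⟨c⟩`-orbit of size `2n - 2`, and `c` has order `2n - 2`. -/
theorem bipartite_coxeter_element_typeD_order_and_orbits
    (n : ℕ) (hn : 4 ≤ n)
    (s : Fin n → (EuclideanSpace ℝ (Fin n) ≃ₗᵢ[ℝ] EuclideanSpace ℝ (Fin n)))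
    (hswap : ∀ (k : Fin n) (hk : k.val + 1 < n),
      s k (EuclideanSpace.single k (1 : ℝ)) = EuclideanSpace.single ⟨k.val + 1, hk⟩ (1 : ℝ) ∧
      s k (EuclideanSpace.single ⟨k.val + 1, hk⟩ (1 : ℝ)) = EuclideanSpace.single k (1 : ℝ) ∧
      ∀ j : Fin n, j ≠ k → j.val ≠ k.val + 1 →
        s k (EuclideanSpace.single j (1 : ℝ)) = EuclideanSpace.single j (1 : ℝ))
    (hlast : ∀ k : Fin n, k.val = n - 1 → ∀ k' : Fin n, k'.val = n - 2 →
      s k (EuclideanSpace.single k' (1 : ℝ)) = -EuclideanSpace.single k (1 : ℝ) ∧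
      s k (EuclideanSpace.single k (1 : ℝ)) = -EuclideanSpace.single k' (1 : ℝ) ∧
      ∀ j : Fin n, j ≠ k → j ≠ k' →
        s k (EuclideanSpace.single j (1 : ℝ)) = EuclideanSpace.single j (1 : ℝ))
    (cplus cminus c : EuclideanSpace ℝ (Fin n) ≃ₗᵢ[ℝ] EuclideanSpace ℝ (Fin n))
    -- `s k` is `s_{k+1}` in 1-based indexing, so for `k.val < n - 1`, `s k ∈ S₊` iff
    -- `k.val` is even; the last generator (`k.val = n - 1`) lies in the same part as the
    -- next-to-last (`k.val = n - 2`), i.e. in `S₊` iff `n` is even.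
    (hcplus : cplus = (((List.finRange n).filter
      (fun k => if k.val = n - 1 then n % 2 = 0 else k.val % 2 = 0)).map s).prod)
    (hcminus : cminus = (((List.finRange n).filter
      (fun k => if k.val = n - 1 then n % 2 ≠ 0 else k.val % 2 ≠ 0)).map s).prod)
    (hc : c = cminus * cplus) :
    c (EuclideanSpace.single (⟨n - 1, by omega⟩ : Fin n) (1 : ℝ))
        = -EuclideanSpace.single (⟨n - 1, by omega⟩ : Fin n) (1 : ℝ) ∧
    (∀ x ∈ {x : EuclideanSpace ℝ (Fin n) | ∃ j : Fin n, j.val < n - 1 ∧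
        (x = EuclideanSpace.single j (1 : ℝ) ∨ x = -EuclideanSpace.single j (1 : ℝ))},
      c x ∈ {x : EuclideanSpace ℝ (Fin n) | ∃ j : Fin n, j.val < n - 1 ∧
        (x = EuclideanSpace.single j (1 : ℝ) ∨ x = -EuclideanSpace.single j (1 : ℝ))}) ∧
    (∀ x ∈ {x : EuclideanSpace ℝ (Fin n) | ∃ j : Fin n, j.val < n - 1 ∧
        (x = EuclideanSpace.single j (1 : ℝ) ∨ x = -EuclideanSpace.single j (1 : ℝ))},
     ∀ y ∈ {x : EuclideanSpace ℝ (Fin n) | ∃ j : Fin n, j.val < n - 1 ∧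
        (x = EuclideanSpace.single j (1 : ℝ) ∨ x = -EuclideanSpace.single j (1 : ℝ))},
      ∃ m : ℤ, (c ^ m) x = y) ∧
    {x : EuclideanSpace ℝ (Fin n) | ∃ j : Fin n, j.val < n - 1 ∧
        (x = EuclideanSpace.single j (1 : ℝ) ∨ x = -EuclideanSpace.single j (1 : ℝ))}.ncard
      = 2 * n - 2 ∧
    orderOf c = 2 * n - 2 := by
  have hs : TypeD.IsSimpleSystem n s :=
    { swap_left := fun k hk => by
        rw [TypeD.stdVec_val, TypeD.stdVec_of_lt hk, (hswap k hk).1]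
      swap_right := fun k hk => by
        rw [TypeD.stdVec_val, TypeD.stdVec_of_lt hk, (hswap k hk).2.1]
      fixed := fun k hk j h₀ h₁ => by
        by_cases hj : j < n
        · rw [TypeD.stdVec_of_lt hj]
          exact (hswap k hk).2.2 _ (by rwa [Ne, Fin.ext_iff]) h₁
        · rw [TypeD.stdVec, dif_neg hj, map_zero]
      last_left := fun k hk => by
        rw [← hk, TypeD.stdVec_val, TypeD.stdVec_of_lt (by omega),
          (hlast k hk ⟨n - 2, by omega⟩ rfl).1]
      last_right := fun k hk => by
        rw [← hk, TypeD.stdVec_val, TypeD.stdVec_of_lt (by omega),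
          (hlast k hk ⟨n - 2, by omega⟩ rfl).2.1]
      last_fixed := fun k hk j h₀ h₁ => by
        by_cases hj : j < n
        · rw [TypeD.stdVec_of_lt hj]
          exact (hlast k hk ⟨n - 2, by omega⟩ rfl).2.2 _ (by rwa [Ne, Fin.ext_iff, hk])
            (by rwa [Ne, Fin.ext_iff])
        · rw [TypeD.stdVec, dif_neg hj, map_zero] }
  have hcox : c = TypeD.coxeter s := by
    simp only [Nat.mod_two_ne_zero] at hcminus
    rw [hc, hcplus, hcminus]
    rfl
  rw [hcox, ← TypeD.stdVec_of_lt]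
  exact ⟨hs.coxeter_apply_last hn, fun x hx => hs.coxeter_apply_mem hn hx,
    fun x hx y hy => hs.exists_coxeter_zpow_apply_eq hn hx hy, TypeD.ncard_signedVecs n,
    hs.orderOf_coxeter hn⟩
end

section
/- For n ≥ 1, a subgroup of the symmetric group on {1, …, n+1} is generated by a set of transpositions if and only if it is conjugate in the symmetric group to a subgroup generated by a subset of the adjacent transpositions {(i, i+1) : 1 ≤ i ≤ n}. -/
/-- The equivalence relation on points identifying `x` and `y` when `H` contains `swap x y`. -/
def Subgroup.swapSetoid {α : Type*} [DecidableEq α] (H : Subgroup (Equiv.Perm α)) : Setoid α where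
  r x y := Equiv.swap x y ∈ H
  iseqv :=
    { refl := fun x => by rw [Equiv.swap_self]; exact H.one_mem
      symm := fun {x y} h => by rwa [Equiv.swap_comm]
      trans := SubmonoidClass.swap_mem_trans H }

/-- If `F` is monotone and the subgroup `K` contains the adjacent transpositions which preserve
`F`, then it contains every transposition which preserves `F`. -/
theorem Subgroup.swap_mem_of_monotone {n : ℕ} {α : Type*} [PartialOrder α] {F : Fin (n + 1) → α}
    (hF : Monotone F) (K : Subgroup (Equiv.Perm (Fin (n + 1))))
    (hK : ∀ i : Fin n, F i.castSucc = F i.succ → Equiv.swap i.castSucc i.succ ∈ K)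
    {a b : Fin (n + 1)} (hab : F a = F b) : Equiv.swap a b ∈ K := by
  wlog hle : a ≤ b generalizing a b
  · rw [Equiv.swap_comm]
    exact this hab.symm (le_of_not_ge hle)
  induction b using Fin.induction with
  | zero =>
    rw [Fin.le_zero_iff.mp hle, Equiv.swap_self]
    exact K.one_mem
  | succ i ih =>
    rcases hle.eq_or_lt with rfl | hlt
    · rw [Equiv.swap_self]
      exact K.one_mem
    · have hai : a ≤ i.castSucc := Fin.le_castSucc_iff.mpr hlt
      have hi : F i.castSucc = F i.succ :=
        le_antisymm (hF (Fin.castSucc_lt_succ).le) (hab ▸ hF hai)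
      exact SubmonoidClass.swap_mem_trans K (ih (hab.trans hi.symm) hai) (hK i hi)

/-- A subgroup of the symmetric group on `{1, …, n+1}` is generated by a
set of transpositions if and only if it is conjugate to a subgroup generated by a subset of
the adjacent transpositions `(i, i+1)`, `1 ≤ i ≤ n` (i.e. iff it is a parabolic subgroup of
the symmetric group viewed as the Coxeter group of type `Aₙ`). -/
theorem generated_by_transpositions_iff_conjugate_to_standard_parabolic
    (n : ℕ) (hn : 1 ≤ n) (H : Subgroup (Equiv.Perm (Fin (n + 1)))) :
    (∃ Ts : Set (Equiv.Perm (Fin (n + 1))), (∀ σ ∈ Ts, σ.IsSwap) ∧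
        H = Subgroup.closure Ts) ↔
      (∃ (g : Equiv.Perm (Fin (n + 1))) (J : Set (Fin n)),
        H = (Subgroup.closure
            {σ : Equiv.Perm (Fin (n + 1)) | ∃ i ∈ J, σ = Equiv.swap i.castSucc i.succ}).map
          (MulAut.conj g).toMonoidHom) := by
  constructor
  · rintro ⟨Ts, hTs, rfl⟩
    set H := Subgroup.closure Ts with hH
    let f : Fin (n + 1) → Fin (n + 1) := fun x => (Quotient.mk H.swapSetoid x).out
    have hf (x y) : f x = f y ↔ Equiv.swap x y ∈ H :=
      Quotient.out_inj.trans Quotient.eq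
    let g := Tuple.sort f
    refine ⟨g, {i | f (g i.castSucc) = f (g i.succ)}, le_antisymm ?_ ?_⟩
    · rw [hH, Subgroup.closure_le]
      intro σ hσ
      obtain ⟨x, y, -, rfl⟩ := hTs σ hσ
      refine ⟨Equiv.swap (g⁻¹ x) (g⁻¹ y), ?_, ?_⟩
      · refine Subgroup.swap_mem_of_monotone (Tuple.monotone_sort f) _ ?_ ?_
        · exact fun i hi => Subgroup.subset_closure ⟨i, hi, rfl⟩
        have hxy : f x = f y := (hf x y).mpr (Subgroup.subset_closure hσ)
        simpa [g] using hxy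
      · simp [← Equiv.swap_apply_apply]
    · rw [Subgroup.map_le_iff_le_comap, Subgroup.closure_le]
      rintro _ ⟨i, hi, rfl⟩
      simpa [← Equiv.swap_apply_apply] using (hf _ _).mp hi
  · rintro ⟨g, J, rfl⟩
    rw [MonoidHom.map_closure]
    refine ⟨_, ?_, rfl⟩
    rintro _ ⟨_, ⟨i, -, rfl⟩, rfl⟩
    refine ⟨g i.castSucc, g i.succ, g.injective.ne (Fin.castSucc_lt_succ).ne, ?_⟩
    simp [Equiv.swap_apply_apply]
end
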